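/- arXiv:1510.03622 — 3 statements merged into one kernel-verified Lean document; each statement's English description precedes it below -/
import Mathlib

section
/- Let f, g ∈ ℝ[x₁,…,x_n] be nonzero polynomials such that there is no constant c ∈ ℝ with f = c·g, let D = {x ∈ ℝ^n : f(x) = 0 or g(x) = 0}, and let Φ : ℝ^n → ℂ be a test function. Define E_Φ(z) = ∫_{ℝ^n ∖ D} Φ(x)·exp(2π√−1·z·f(x)/g(x)) dx for z ∈ ℝ. Then there exist a real number β < 0, an integer m ≥ 1, and a constant C > 0 such that for all z ∈ ℝ with |z| ≥ 2: |E_Φ(z)| ≤ C · |z|^β · (ln|z|)^{m−1}. -/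
open MeasureTheory Complex MvPolynomial

theorem hasLineDerivAt_eval_mvPolynomial {n : ℕ} (p : MvPolynomial (Fin n) ℝ) (i : Fin n)
    (x : Fin n → ℝ) :
    HasLineDerivAt ℝ (fun y => eval y p) (eval x (pderiv i p)) x (Pi.single i 1) := by
  unfold HasLineDerivAt
  induction p using MvPolynomial.induction_on with
  | C a => simpa using hasDerivAt_const (0 : ℝ) a
  | add p q hp hq => simpa using hp.fun_add hq
  | mul_X p j hp =>
    have hX : HasDerivAt (fun t : ℝ => x j + t * (Pi.single i 1 : Fin n → ℝ) j)
        ((Pi.single i 1 : Fin n → ℝ) j) 0 := by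
      simpa using
        ((hasDerivAt_id (0 : ℝ)).mul_const ((Pi.single i 1 : Fin n → ℝ) j)).const_add (x j)
    have h := hp.fun_mul hX
    simp only [zero_mul, add_zero, zero_smul] at h
    rw [pderiv_mul, map_add, map_mul, map_mul, eval_X]
    simp only [map_mul, eval_X, Pi.add_apply, Pi.smul_apply, smul_eq_mul]
    refine h.congr_deriv ?_
    by_cases hij : i = j
    · subst hij; simp
    · simp [Ne.symm hij, pderiv_X_of_ne (Ne.symm hij)]

theorem totalDegree_pderiv_lt {σ R : Type*} [CommSemiring R] {p : MvPolynomial σ R} {i : σ}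
    (h : pderiv i p ≠ 0) : (pderiv i p).totalDegree < p.totalDegree := by
  classical
  obtain ⟨m, hm, hdeg⟩ := Finset.exists_mem_eq_sup (pderiv i p).support
    (MvPolynomial.support_nonempty.2 h) (fun s => s.sum fun _ e => e)
  rw [mem_support_iff, coeff_pderiv] at hm
  have := le_totalDegree (p := p) (s := m + Finsupp.single i 1)
    (mem_support_iff.2 (left_ne_zero_of_mul hm))
  rw [Finsupp.sum_add_index' (by simp) (by simp), Finsupp.sum_single_index rfl] at this
  rw [totalDegree, hdeg]
  exact this

theorem contDiff_eval_mvPolynomial {n : ℕ} (p : MvPolynomial (Fin n) ℝ) :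
    ContDiff ℝ (⊤ : ℕ∞) (fun x : Fin n → ℝ => eval x p) :=
  contDiffOn_univ.1 ((AnalyticOnNhd.eval_mvPolynomial p).contDiffOn uniqueDiffOn_univ)

theorem exists_pderiv_wronskian_ne_zero {n : ℕ} {f g : MvPolynomial (Fin n) ℝ} (hg : g ≠ 0)
    (hfg : ∀ c : ℝ, f ≠ c • g) : ∃ i, g * pderiv i f - f * pderiv i g ≠ 0 := by
  by_contra! H
  obtain ⟨x₀, hx₀⟩ : ∃ x, eval x g ≠ 0 := by
    by_contra! h
    exact hg (MvPolynomial.funext (by simpa using h))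
  have hgc : Continuous fun x : Fin n → ℝ => eval x g := continuous_eval g
  obtain ⟨r, hr, hball⟩ := Metric.isOpen_iff.1 (isOpen_ne_fun hgc continuous_const) x₀ hx₀
  have hdiff : ∀ p : MvPolynomial (Fin n) ℝ, Differentiable ℝ fun x : Fin n → ℝ => eval x p :=
    fun p => (contDiff_eval_mvPolynomial p).differentiable (by simp)
  have hd : ∀ x ∈ Metric.ball x₀ r,
      DifferentiableAt ℝ (fun y : Fin n → ℝ => eval y f / eval y g) x := fun x hx =>
    by
    simpa only [div_eq_mul_inv] using (hdiff f x).fun_mul ((hdiff g x).fun_inv (hball hx))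
  have hconst : ∀ x ∈ Metric.ball x₀ r, eval x f / eval x g = eval x₀ f / eval x₀ g := by
    intro x hx
    refine (convex_ball x₀ r).is_const_of_fderivWithin_eq_zero (𝕜 := ℝ)
      (f := fun y => eval y f / eval y g) (fun y hy => (hd y hy).differentiableWithinAt) ?_ hx
      (Metric.mem_ball_self hr)
    intro y hy
    rw [fderivWithin_of_isOpen Metric.isOpen_ball hy]
    refine ContinuousLinearMap.coe_injective ((Pi.basisFun ℝ (Fin n)).ext fun i => ?_)
    have h1 := (hd y hy).hasFDerivAt.hasLineDerivAt (Pi.single i 1)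
    have hgy : eval y g ≠ 0 := hball hy
    have h2 := HasDerivAt.div (hasLineDerivAt_eval_mvPolynomial f i y)
      (hasLineDerivAt_eval_mvPolynomial g i y) (by simpa using hgy)
    have h3 := h1.unique h2
    have h4 := congrArg (eval y) (H i)
    simp only [map_sub, map_mul, map_zero] at h4
    simp only [zero_smul, add_zero] at h3
    rw [Pi.basisFun_apply, ContinuousLinearMap.coe_coe, h3, div_eq_zero_iff.2 (Or.inl (by linarith))]
    rfl
  refine hfg (eval x₀ f / eval x₀ g) ?_
  refine funext_set (fun i => Metric.ball (x₀ i) r) (fun i => ?_) fun x hx => ?_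
  · rw [Real.ball_eq_Ioo]; exact Set.Ioo_infinite (by linarith)
  · rw [← ball_pi _ hr] at hx
    rw [smul_eval, ← hconst x hx, div_mul_cancel₀ _ (hball hx)]

theorem exists_pderiv_ne_zero {n : ℕ} {p : MvPolynomial (Fin n) ℝ} (hp : ∀ c, p ≠ C c) :
    ∃ i, pderiv i p ≠ 0 := by
  simpa using exists_pderiv_wronskian_ne_zero (f := p) one_ne_zero
    (fun c => by simpa [smul_eq_C_mul] using hp c)

theorem regularized_inv_bounds {s μ : ℝ} (hμ : 0 < μ) (hμ1 : μ ≤ 1) :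
    |s / (s ^ 2 + μ ^ 2)| ≤ 1 / μ ^ 2 ∧
      |(μ ^ 2 - s ^ 2) / (s ^ 2 + μ ^ 2) ^ 2| ≤ 1 / μ ^ 2 := by
  have hpos : 0 < s ^ 2 + μ ^ 2 := by positivity
  constructor
  · rw [abs_div, abs_of_pos hpos, div_le_div_iff₀ hpos (by positivity)]
    have : |s| * μ ≤ s ^ 2 + μ ^ 2 := by
      rw [← sq_abs s]; nlinarith [sq_nonneg (|s| - μ), sq_nonneg (|s|), sq_nonneg μ]
    nlinarith [abs_nonneg s, mul_nonneg (abs_nonneg s) hμ.le]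
  · rw [abs_div, abs_of_pos (pow_pos hpos 2), div_le_div_iff₀ (by positivity) (by positivity)]
    have : |μ ^ 2 - s ^ 2| ≤ s ^ 2 + μ ^ 2 := abs_le.2 ⟨by nlinarith, by nlinarith⟩
    nlinarith [sq_nonneg s, mul_nonneg (abs_nonneg (μ ^ 2 - s ^ 2)) (sq_nonneg s), sq_nonneg μ]

theorem hasDerivAt_regularized_inv {s μ : ℝ} (hμ : 0 < μ) :
    HasDerivAt (fun s : ℝ => s / (s ^ 2 + μ ^ 2)) ((μ ^ 2 - s ^ 2) / (s ^ 2 + μ ^ 2) ^ 2) s := by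
  have hpos : s ^ 2 + μ ^ 2 ≠ 0 := by positivity
  have h := (hasDerivAt_id s).fun_div (((hasDerivAt_id s).fun_pow 2).add_const (μ ^ 2)) hpos
  refine h.congr_deriv ?_
  simp only [id]
  ring

theorem exists_norm_integral_regularized_inv_mul_le {𝕜 : Type*} [RCLike 𝕜] {n : ℕ}
    (q : MvPolynomial (Fin n) ℝ) (i : Fin n) {φ : (Fin n → ℝ) → 𝕜}
    (hφ : ContDiff ℝ (⊤ : ℕ∞) φ) (hφc : HasCompactSupport φ) :
    ∃ C, 0 ≤ C ∧ ∀ μ M : ℝ, 0 < μ → μ ≤ 1 → 0 ≤ M → ∀ w w' : (Fin n → ℝ) → 𝕜,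
      (∀ x, HasLineDerivAt ℝ w (w' x) x (Pi.single i 1)) → Measurable w →
      (∀ x ∈ tsupport φ, ‖w x‖ ≤ M) → IntegrableOn w' (tsupport φ) →
      ‖∫ x, ((eval x q / (eval x q ^ 2 + μ ^ 2) : ℝ) • φ x) * w' x‖ ≤ C * M / μ ^ 2 := by
  have hdiff : Differentiable ℝ φ := hφ.differentiable (by simp)
  have hφ' : Continuous fun x => fderiv ℝ φ x (Pi.single i 1) :=
    (hφ.continuous_fderiv (by simp)).clm_apply continuous_const
  have hq : Continuous fun x : Fin n → ℝ => eval x q := continuous_eval q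
  have hdq : Continuous fun x : Fin n → ℝ => eval x (pderiv i q) := continuous_eval _
  set b : (Fin n → ℝ) → ℝ := fun x =>
    ‖eval x (pderiv i q)‖ * ‖φ x‖ + ‖fderiv ℝ φ x (Pi.single i 1)‖ with hb
  have hbc : Continuous b := by fun_prop
  have hz : ∀ x ∉ tsupport φ, φ x = 0 ∧ fderiv ℝ φ x (Pi.single i 1) = 0 := fun x hx =>
    ⟨image_eq_zero_of_notMem_tsupport hx, by
      rw [image_eq_zero_of_notMem_tsupport (fun h => hx (tsupport_fderiv_subset ℝ h))]; rfl⟩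
  have hbs : HasCompactSupport b := by
    refine HasCompactSupport.intro hφc fun x hx => ?_
    simp [hb, hz x hx]
  have hbi : Integrable b := hbc.integrable_of_hasCompactSupport hbs
  refine ⟨∫ x, b x, integral_nonneg fun x => by positivity, ?_⟩
  intro μ M hμ hμ1 hM w w' hw hwm hwM hw'
  have hden : ∀ x : Fin n → ℝ, eval x q ^ 2 + μ ^ 2 ≠ 0 := fun x => by positivity
  set ψ : (Fin n → ℝ) → 𝕜 := fun x => (eval x q / (eval x q ^ 2 + μ ^ 2) : ℝ) • φ x with hψ
  set ψ' : (Fin n → ℝ) → 𝕜 := fun x =>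
    (eval x q / (eval x q ^ 2 + μ ^ 2) : ℝ) • fderiv ℝ φ x (Pi.single i 1) +
    ((μ ^ 2 - eval x q ^ 2) / (eval x q ^ 2 + μ ^ 2) ^ 2 * eval x (pderiv i q) : ℝ) • φ x with hψ'
  have hψc : Continuous ψ := by fun_prop (disch := assumption)
  have hψ'c : Continuous ψ' := by
    have : ∀ x : Fin n → ℝ, (eval x q ^ 2 + μ ^ 2) ^ 2 ≠ 0 := fun x => pow_ne_zero _ (hden x)
    fun_prop (disch := assumption)
  have hψd : ∀ x, HasLineDerivAt ℝ ψ (ψ' x) x (Pi.single i 1) := by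
    intro x
    have h1 := hasLineDerivAt_eval_mvPolynomial q i x
    have h2 := ((hdiff x).hasFDerivAt.hasLineDerivAt (Pi.single i 1))
    unfold HasLineDerivAt at h1 h2 ⊢
    have h3 := (hasDerivAt_regularized_inv (s := eval x q) hμ).comp_of_eq (0 : ℝ) h1 (by simp)
    have h4 := h3.fun_smul h2
    simpa [hψ, hψ'] using h4
  have hψz : ∀ x ∉ tsupport φ, ψ x = 0 ∧ ψ' x = 0 := fun x hx => by
    simp [hψ, hψ', hz x hx]
  have hbound : ∀ x, ‖ψ' x * w x‖ ≤ M / μ ^ 2 * b x := by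
    intro x
    by_cases hx : x ∈ tsupport φ
    · obtain ⟨h1, h2⟩ := regularized_inv_bounds (s := eval x q) hμ hμ1
      have h3 : ‖ψ' x‖ ≤ 1 / μ ^ 2 * b x := by
        refine (norm_add_le _ _).trans ?_
        rw [norm_smul, norm_smul, norm_mul, hb]
        simp only [← Real.norm_eq_abs] at h1 h2
        have h5 := mul_le_mul_of_nonneg_right h1 (norm_nonneg (fderiv ℝ φ x (Pi.single i 1)))
        have h6 := mul_le_mul_of_nonneg_right h2
          (mul_nonneg (norm_nonneg (eval x (pderiv i q))) (norm_nonneg (φ x)))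
        linarith
      rw [norm_mul]
      refine (mul_le_mul h3 (hwM x hx) (norm_nonneg _) (by positivity)).trans_eq (by ring)
    · rw [(hψz x hx).2]; simp; positivity
  have hcs : ∀ {η : (Fin n → ℝ) → 𝕜}, Continuous η → (∀ x ∉ tsupport φ, η x = 0) →
      HasCompactSupport η := fun _ h => HasCompactSupport.intro hφc h
  have hψw : Integrable fun x => ψ x * w x := by
    obtain ⟨K, hK⟩ := hψc.bounded_above_of_compact_support (hcs hψc fun x hx => (hψz x hx).1)
    refine Integrable.mono' (g := fun x => M * ‖ψ x‖)
      ((hψc.integrable_of_hasCompactSupport (hcs hψc fun x hx => (hψz x hx).1)).norm.const_mul M)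
      (hψc.measurable.mul hwm).aestronglyMeasurable (Filter.Eventually.of_forall fun x => ?_)
    by_cases hx : x ∈ tsupport φ
    · rw [norm_mul, mul_comm]
      exact mul_le_mul_of_nonneg_right (hwM x hx) (norm_nonneg _)
    · simp [(hψz x hx).1]
  have hψ'w : Integrable fun x => ψ' x * w x :=
    (hbi.const_mul _).mono' (hψ'c.measurable.mul hwm).aestronglyMeasurable
      (Filter.Eventually.of_forall hbound)
  have hψw' : Integrable fun x => ψ x * w' x := by
    have : IntegrableOn (fun x => ψ x * w' x) (tsupport φ) :=
      hw'.continuousOn_mul hψc.continuousOn hφc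
    refine (integrableOn_iff_integrable_of_support_subset fun x hx => ?_).1 this
    by_contra h
    simp [(hψz x h).1] at hx
  have key := integral_bilinear_hasLineDerivAt_right_eq_neg_left_of_integrable
    (B := ContinuousLinearMap.mul ℝ 𝕜) (μ := volume) hψ'w hψw' hψw (fun x _ => hψd x) (fun x _ => hw x)
  simp only [ContinuousLinearMap.mul_apply'] at key
  rw [key, norm_neg]
  refine (norm_integral_le_of_norm_le (hbi.const_mul _)
    (Filter.Eventually.of_forall hbound)).trans_eq ?_
  rw [integral_const_mul]
  ring

theorem exists_integral_mul_regularized_le_rpow {n : ℕ} {φ : (Fin n → ℝ) → ℝ}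
    (hφ : ContDiff ℝ (⊤ : ℕ∞) φ) (hφc : HasCompactSupport φ) (hφ0 : ∀ x, 0 ≤ φ x)
    {p : MvPolynomial (Fin n) ℝ} (hp : p ≠ 0) :
    ∃ δ C : ℝ, 0 < δ ∧ 0 ≤ C ∧ ∀ ε : ℝ, 0 < ε → ε ≤ 1 →
      ∫ x, φ x * (ε ^ 2 / (eval x p ^ 2 + ε ^ 2)) ≤ C * ε ^ δ := by
  have hreg : ∀ (r : MvPolynomial (Fin n) ℝ) (ε : ℝ), 0 < ε →
      Integrable fun x => φ x * (ε ^ 2 / (eval x r ^ 2 + ε ^ 2)) := by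
    intro r ε hε
    have hr : Continuous fun x : Fin n → ℝ => eval x r := continuous_eval r
    have hφcont := hφ.continuous
    have hden : ∀ x : Fin n → ℝ, eval x r ^ 2 + ε ^ 2 ≠ 0 := fun x => by positivity
    exact Continuous.integrable_of_hasCompactSupport (by fun_prop (disch := assumption))
      hφc.mul_right
  induction hN : p.totalDegree using Nat.strong_induction_on generalizing p with
  | _ N ih =>
  by_cases hconst : ∃ c, p = C c
  · obtain ⟨c, rfl⟩ := hconst
    have hc : c ≠ 0 := fun h => hp (by simp [h])
    refine ⟨2, (∫ x, φ x) / c ^ 2, two_pos, div_nonneg (integral_nonneg hφ0) (sq_nonneg c), ?_⟩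
    intro ε hε _
    simp only [eval_C]
    rw [integral_mul_const, Real.rpow_two, div_mul_eq_mul_div, mul_div_assoc]
    refine mul_le_mul_of_nonneg_left ?_ (integral_nonneg hφ0)
    exact div_le_div_of_nonneg_left (sq_nonneg ε) (by positivity) (by nlinarith [sq_nonneg ε])
  · push Not at hconst
    obtain ⟨i, hi⟩ := exists_pderiv_ne_zero hconst
    obtain ⟨δ, C₁, hδ, hC₁, h₁⟩ := ih _ (hN ▸ totalDegree_pderiv_lt hi) hi rfl
    obtain ⟨C₂, hC₂, h₂⟩ := exists_norm_integral_regularized_inv_mul_le (pderiv i p) i hφ hφc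
    refine ⟨min (δ / 4) (1 / 2), C₁ + C₂ * 2, by positivity, by positivity, ?_⟩
    intro ε hε hε1
    set μ : ℝ := ε ^ (1 / 4 : ℝ) with hμdef
    have hμ : 0 < μ := Real.rpow_pos_of_pos hε _
    have hμ1 : μ ≤ 1 := Real.rpow_le_one hε.le hε1 (by norm_num)
    have hμδ : μ ^ δ = ε ^ (δ / 4) := by
      rw [hμdef, ← Real.rpow_mul hε.le]; congr 1; ring
    have hμ2 : ε / μ ^ 2 = ε ^ (1 / 2 : ℝ) := by
      rw [hμdef, ← Real.rpow_natCast, ← Real.rpow_mul hε.le, div_eq_iff (by positivity),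
        ← Real.rpow_add hε]
      norm_num
    set w : (Fin n → ℝ) → ℝ := fun x => Real.arctan (eval x p / ε) with hw
    set w' : (Fin n → ℝ) → ℝ := fun x =>
      1 / (1 + (eval x p / ε) ^ 2) * (eval x (pderiv i p) / ε) with hw'
    have hpc : Continuous fun x : Fin n → ℝ => eval x p := continuous_eval p
    have hqc : Continuous fun x : Fin n → ℝ => eval x (pderiv i p) := continuous_eval _
    have hwc : Continuous w := Real.continuous_arctan.comp (hpc.div_const ε)
    have hwc' : Continuous w' := by
      have : ∀ x : Fin n → ℝ, 1 + (eval x p / ε) ^ 2 ≠ 0 := fun x => by positivity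
      fun_prop (disch := assumption)
    have hwd : ∀ x, HasLineDerivAt ℝ w (w' x) x (Pi.single i 1) := by
      intro x
      have h := HasDerivAt.arctan
        (HasDerivAt.div_const (hasLineDerivAt_eval_mvPolynomial p i x) ε)
      simp only [zero_smul, add_zero] at h
      exact h
    have hwM : ∀ x, ‖w x‖ ≤ 2 := fun x => by
      have h1 := Real.neg_pi_div_two_lt_arctan (eval x p / ε)
      have h2 := Real.arctan_lt_pi_div_two (eval x p / ε)
      have h3 := Real.pi_le_four
      exact abs_le.2 ⟨by simp only [hw]; linarith, by simp only [hw]; linarith⟩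
    have h3 := h₂ μ 2 hμ hμ1 zero_le_two w w' hwd hwc.measurable (fun x _ => hwM x)
      (hwc'.continuousOn.integrableOn_compact hφc)
    have hψi : Integrable fun x => ((eval x (pderiv i p) /
        (eval x (pderiv i p) ^ 2 + μ ^ 2) : ℝ) • φ x) * w' x := by
      have hφcont := hφ.continuous
      have hden : ∀ x : Fin n → ℝ, eval x (pderiv i p) ^ 2 + μ ^ 2 ≠ 0 := fun x => by positivity
      refine Continuous.integrable_of_hasCompactSupport
        (by fun_prop (disch := assumption)) ?_
      exact (hφc.smul_left (f := fun x => eval x (pderiv i p) /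
        (eval x (pderiv i p) ^ 2 + μ ^ 2))).mul_right
    have hpt : ∀ x, φ x * (ε ^ 2 / (eval x p ^ 2 + ε ^ 2)) ≤
        φ x * (μ ^ 2 / (eval x (pderiv i p) ^ 2 + μ ^ 2)) + ε * (((eval x (pderiv i p) /
        (eval x (pderiv i p) ^ 2 + μ ^ 2) : ℝ) • φ x) * w' x) := by
      intro x
      simp only [hw', smul_eq_mul]
      set a := eval x p
      set b := eval x (pderiv i p)
      have e1 : 1 / (1 + (a / ε) ^ 2) * (b / ε) = b * ε / (a ^ 2 + ε ^ 2) := by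
        field_simp
        ring
      have e2 : ε ^ 2 / (a ^ 2 + ε ^ 2) = μ ^ 2 / (b ^ 2 + μ ^ 2) * (ε ^ 2 / (a ^ 2 + ε ^ 2)) +
          ε * (b / (b ^ 2 + μ ^ 2) * (b * ε / (a ^ 2 + ε ^ 2))) := by
        field_simp
        ring
      have e3 : ε ^ 2 / (a ^ 2 + ε ^ 2) ≤ 1 := (div_le_one (by positivity)).2 (by nlinarith)
      have e4 : μ ^ 2 / (b ^ 2 + μ ^ 2) * (ε ^ 2 / (a ^ 2 + ε ^ 2)) ≤ μ ^ 2 / (b ^ 2 + μ ^ 2) :=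
        mul_le_of_le_one_right (by positivity) e3
      rw [e1]
      have e5 := mul_le_mul_of_nonneg_left (e2.le.trans (add_le_add_left e4 _)) (hφ0 x)
      linarith
    calc _ ≤ ∫ x, (φ x * (μ ^ 2 / (eval x (pderiv i p) ^ 2 + μ ^ 2)) + ε * (((eval x (pderiv i p) /
          (eval x (pderiv i p) ^ 2 + μ ^ 2) : ℝ) • φ x) * w' x)) :=
          integral_mono (hreg p ε hε) ((hreg _ μ hμ).add (hψi.const_mul ε)) hpt
      _ ≤ C₁ * μ ^ δ + ε * (C₂ * 2 / μ ^ 2) := by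
          rw [integral_add (hreg _ μ hμ) (hψi.const_mul ε), integral_const_mul]
          exact add_le_add (h₁ μ hμ hμ1)
            (mul_le_mul_of_nonneg_left ((le_abs_self _).trans h3) hε.le)
      _ = C₁ * ε ^ (δ / 4) + C₂ * 2 * ε ^ (1 / 2 : ℝ) := by rw [hμδ, ← hμ2]; ring
      _ ≤ C₁ * ε ^ min (δ / 4) (1 / 2) + C₂ * 2 * ε ^ min (δ / 4) (1 / 2) := by
          gcongr ?_ * ?_ + ?_ * ?_
          · exact Real.rpow_le_rpow_of_exponent_ge hε hε1 (min_le_left _ _)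
          · exact Real.rpow_le_rpow_of_exponent_ge hε hε1 (min_le_right _ _)
      _ = _ := by ring

theorem exists_integral_norm_mul_regularized_le_rpow {F : Type*} [NormedAddCommGroup F] {n : ℕ}
    {φ : (Fin n → ℝ) → F} (hφ : Continuous φ) (hφc : HasCompactSupport φ)
    {p : MvPolynomial (Fin n) ℝ} (hp : p ≠ 0) :
    ∃ δ C : ℝ, 0 < δ ∧ 0 ≤ C ∧ ∀ ε : ℝ, 0 < ε → ε ≤ 1 →
      ∫ x, ‖φ x‖ * (ε ^ 2 / (eval x p ^ 2 + ε ^ 2)) ≤ C * ε ^ δ := by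
  obtain ⟨R, hR, hsub⟩ := hφc.isBounded.subset_closedBall_lt 0 0
  let χ : ContDiffBump (0 : Fin n → ℝ) := ⟨R, R + 1, hR, by linarith⟩
  obtain ⟨K, hK⟩ := hφ.bounded_above_of_compact_support hφc
  obtain ⟨δ, C, hδ, hC, h⟩ := exists_integral_mul_regularized_le_rpow
    (φ := fun x => χ x) χ.contDiff χ.hasCompactSupport (fun _ => χ.nonneg) hp
  have hK0 : 0 ≤ K := (norm_nonneg _).trans (hK 0)
  refine ⟨δ, K * C, hδ, by positivity, fun ε hε hε1 => ?_⟩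
  have hpc : Continuous fun x : Fin n → ℝ => eval x p := continuous_eval p
  have hden : ∀ x : Fin n → ℝ, eval x p ^ 2 + ε ^ 2 ≠ 0 := fun x => by positivity
  have hχc : Continuous fun x => χ x := χ.continuous
  calc _ ≤ ∫ x, K * (χ x * (ε ^ 2 / (eval x p ^ 2 + ε ^ 2))) := by
        refine integral_mono ?_ ?_ fun x => ?_
        · exact Continuous.integrable_of_hasCompactSupport (by fun_prop (disch := assumption))
            hφc.norm.mul_right
        · refine Integrable.const_mul ?_ K
          exact Continuous.integrable_of_hasCompactSupport (by fun_prop (disch := assumption))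
            (χ.hasCompactSupport.mul_right)
        · have h1 : ‖φ x‖ ≤ K * χ x := by
            by_cases hx : x ∈ tsupport φ
            · rw [χ.one_of_mem_closedBall (hsub hx), mul_one]; exact hK x
            · rw [image_eq_zero_of_notMem_tsupport hx, norm_zero]
              exact mul_nonneg hK0 χ.nonneg
          simp only [← mul_assoc]
          exact mul_le_mul_of_nonneg_right h1 (by positivity)
    _ ≤ K * (C * ε ^ δ) := by
        rw [integral_const_mul]
        exact mul_le_mul_of_nonneg_left (h ε hε hε1) hK0
    _ = _ := by ring

/-- The phase factor `exp (2πi z f / g)`, set to zero on the polar locus `g = 0`. -/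
noncomputable def rationalPhase {n : ℕ} (f g : MvPolynomial (Fin n) ℝ) (z : ℝ)
    (x : Fin n → ℝ) : ℂ :=
  if eval x g = 0 then 0 else
    Complex.exp (2 * Real.pi * Complex.I * ((z * (eval x f / eval x g) : ℝ) : ℂ))

theorem norm_rationalPhase_le_one {n : ℕ} (f g : MvPolynomial (Fin n) ℝ) (z : ℝ)
    (x : Fin n → ℝ) : ‖rationalPhase f g z x‖ ≤ 1 := by
  unfold rationalPhase
  split_ifs
  · simp
  · rw [Complex.norm_exp]; simp

theorem measurable_rationalPhase {n : ℕ} (f g : MvPolynomial (Fin n) ℝ) (z : ℝ) :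
    Measurable (rationalPhase f g z) := by
  have hf : Measurable fun x : Fin n → ℝ => eval x f := (continuous_eval f).measurable
  have hg : Measurable fun x : Fin n → ℝ => eval x g := (continuous_eval g).measurable
  exact Measurable.ite (hg (measurableSet_singleton 0)) measurable_const (by fun_prop)

theorem hasLineDerivAt_sq_mul_rationalPhase {n : ℕ} (f g : MvPolynomial (Fin n) ℝ) (z : ℝ)
    (i : Fin n) (x : Fin n → ℝ) :
    HasLineDerivAt ℝ (fun y => ((eval y g ^ 2 : ℝ) : ℂ) * rationalPhase f g z y)
      (((2 * eval x g * eval x (pderiv i g) : ℝ) : ℂ) * rationalPhase f g z x +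
        2 * Real.pi * Complex.I * z * (((eval x (g * pderiv i f - f * pderiv i g) : ℝ) : ℂ) *
          rationalPhase f g z x)) x (Pi.single i 1) := by
  have hf := hasLineDerivAt_eval_mvPolynomial f i x
  have hg := hasLineDerivAt_eval_mvPolynomial g i x
  unfold HasLineDerivAt at hf hg ⊢
  have hg2 := hg.fun_pow 2
  simp only [zero_smul, add_zero] at hg2
  by_cases h0 : eval x g = 0
  · have hx : rationalPhase f g z x = 0 := if_pos h0
    rw [h0] at hg2
    rw [hx, mul_zero, mul_zero, mul_zero, add_zero]
    rw [hasDerivAt_iff_isLittleO] at hg2 ⊢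
    refine Asymptotics.IsBigO.trans_isLittleO (Asymptotics.IsBigO.of_bound 1 ?_) hg2
    refine Filter.Eventually.of_forall fun t => ?_
    have := mul_le_of_le_one_right (sq_nonneg (eval (x + t • Pi.single i 1) g))
      (norm_rationalPhase_le_one f g z (x + t • Pi.single i 1))
    simpa [h0] using this
  · have hdiv := hf.fun_div hg (by simpa using h0)
    have hexp := (((hdiv.const_mul z).ofReal_comp).const_mul
      (2 * Real.pi * Complex.I : ℂ)).cexp
    have hmul := hg2.ofReal_comp.fun_mul hexp
    simp only [zero_smul, add_zero] at hmul
    have hx : rationalPhase f g z x = Complex.exp (2 * Real.pi * Complex.I *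
      ((z * (eval x f / eval x g) : ℝ) : ℂ)) := if_neg h0
    have hne : ∀ᶠ t : ℝ in nhds 0, eval (x + t • Pi.single i 1) g ≠ 0 :=
      hg.continuousAt.eventually_ne (by simpa using h0)
    refine (hmul.congr_of_eventuallyEq ?_).congr_deriv ?_
    · filter_upwards [hne] with t ht
      simp only [rationalPhase, if_neg ht]
    · have h0' : ((eval x g : ℝ) : ℂ) ≠ 0 := by exact_mod_cast h0
      rw [hx]
      push_cast [map_sub, map_mul]
      field_simp

theorem exists_norm_integral_mul_rationalPhase_le {n : ℕ} {f g : MvPolynomial (Fin n) ℝ}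
    {i : Fin n} {Φ : (Fin n → ℝ) → ℂ} (hΦ : ContDiff ℝ (⊤ : ℕ∞) Φ)
    (hΦc : HasCompactSupport Φ) :
    ∃ C, 0 ≤ C ∧ ∀ z ε : ℝ, z ≠ 0 → 0 < ε → ε ≤ 1 →
      ‖∫ x, Φ x * ((eval x (g * pderiv i f - f * pderiv i g) ^ 2 /
        (eval x (g * pderiv i f - f * pderiv i g) ^ 2 + ε ^ 2) : ℝ) : ℂ) *
          rationalPhase f g z x‖ ≤ C / (|z| * ε ^ 2) := by
  set P := g * pderiv i f - f * pderiv i g with hP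
  obtain ⟨C, hC, h⟩ := exists_norm_integral_regularized_inv_mul_le P i hΦ hΦc
  have hgc : Continuous fun x : Fin n → ℝ => eval x g := continuous_eval g
  have hdgc : Continuous fun x : Fin n → ℝ => eval x (pderiv i g) := continuous_eval _
  have hPc : Continuous fun x : Fin n → ℝ => eval x P := continuous_eval P
  have hΦcont := hΦ.continuous
  obtain ⟨M, hM⟩ := hΦc.exists_bound_of_continuousOn (f := fun x => eval x g ^ 2)
    (hgc.pow 2).continuousOn
  set b : (Fin n → ℝ) → ℝ := fun x => ‖Φ x‖ * |2 * eval x g * eval x (pderiv i g)| with hb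
  have hbi : Integrable b :=
    Continuous.integrable_of_hasCompactSupport (by fun_prop) hΦc.norm.mul_right
  have hB : 0 ≤ ∫ x, b x := integral_nonneg fun x => by positivity
  refine ⟨C * |M| + ∫ x, b x, by positivity, fun z ε hz hε hε1 => ?_⟩
  have hum := measurable_rationalPhase f g z
  have hu1 := norm_rationalPhase_le_one f g z
  set u := rationalPhase f g z with hu
  have hden : ∀ x : Fin n → ℝ, eval x P ^ 2 + ε ^ 2 ≠ 0 := fun x => by positivity
  have hcu : ∀ {η : (Fin n → ℝ) → ℂ}, Continuous η → HasCompactSupport η →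
      Integrable fun x => η x * u x := fun hη hηc =>
    (hη.integrable_of_hasCompactSupport hηc).mul_bdd hum.aestronglyMeasurable
      (Filter.Eventually.of_forall hu1)
  have hKu : ∀ {η : (Fin n → ℝ) → ℂ}, Continuous η →
      IntegrableOn (fun x => η x * u x) (tsupport Φ) := fun hη =>
    Integrable.mul_bdd (hη.continuousOn.integrableOn_compact hΦc) hum.aestronglyMeasurable
      (Filter.Eventually.of_forall hu1)
  have h1 := h ε |M| hε hε1 (abs_nonneg M) (fun y => ((eval y g ^ 2 : ℝ) : ℂ) * u y) _
    (hasLineDerivAt_sq_mul_rationalPhase f g z i) (by fun_prop)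
    (fun x hx => by
      rw [norm_mul, Complex.norm_real]
      exact (mul_le_of_le_one_right (norm_nonneg _) (hu1 x)).trans ((hM x hx).trans (le_abs_self M)))
    ((hKu (by fun_prop)).add ((hKu (by fun_prop)).const_mul _))
  simp only [← hP, ← hu] at h1
  clear_value u P
  have e : ∀ x, ((eval x P / (eval x P ^ 2 + ε ^ 2) : ℝ) • Φ x) *
      (((2 * eval x g * eval x (pderiv i g) : ℝ) : ℂ) * u x +
        2 * Real.pi * Complex.I * z * (((eval x P : ℝ) : ℂ) * u x)) =
      (((eval x P / (eval x P ^ 2 + ε ^ 2) : ℝ) • Φ x) *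
        ((2 * eval x g * eval x (pderiv i g) : ℝ) : ℂ)) * u x +
      2 * Real.pi * Complex.I * z * (Φ x * ((eval x P ^ 2 / (eval x P ^ 2 + ε ^ 2) : ℝ) : ℂ) *
        u x) := by
    intro x
    rw [Complex.real_smul]
    push_cast
    ring
  have hi1 : Integrable fun x => (((eval x P / (eval x P ^ 2 + ε ^ 2) : ℝ) • Φ x) *
        ((2 * eval x g * eval x (pderiv i g) : ℝ) : ℂ)) * u x :=
    hcu (by fun_prop (disch := assumption))
      (HasCompactSupport.intro hΦc fun x hx => by
        rw [image_eq_zero_of_notMem_tsupport hx, smul_zero, zero_mul])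
  have hi2 : Integrable fun x => Φ x * ((eval x P ^ 2 / (eval x P ^ 2 + ε ^ 2) : ℝ) : ℂ) *
        u x :=
    hcu (by fun_prop (disch := assumption)) hΦc.mul_right
  have hb1 : ‖∫ x, (((eval x P / (eval x P ^ 2 + ε ^ 2) : ℝ) • Φ x) *
        ((2 * eval x g * eval x (pderiv i g) : ℝ) : ℂ)) * u x‖ ≤ (∫ x, b x) / ε ^ 2 := by
    rw [div_eq_inv_mul, ← integral_const_mul]
    refine norm_integral_le_of_norm_le (hbi.const_mul _) (Filter.Eventually.of_forall fun x => ?_)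
    rw [norm_mul]
    refine (mul_le_of_le_one_right (norm_nonneg _) (hu1 x)).trans ?_
    rw [norm_mul, norm_smul, Complex.norm_real, mul_assoc, ← one_div]
    exact mul_le_mul_of_nonneg_right (regularized_inv_bounds hε hε1).1 (by positivity)
  simp only [e] at h1
  rw [integral_add hi1 (hi2.const_mul _), integral_const_mul] at h1
  set I₁ := ∫ x, (((eval x P / (eval x P ^ 2 + ε ^ 2) : ℝ) • Φ x) *
        ((2 * eval x g * eval x (pderiv i g) : ℝ) : ℂ)) * u x
  set I₂ := ∫ x, Φ x * ((eval x P ^ 2 / (eval x P ^ 2 + ε ^ 2) : ℝ) : ℂ) * u x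
  have h2 : ‖2 * Real.pi * Complex.I * z * I₂‖ ≤ (C * |M| + ∫ x, b x) / ε ^ 2 := by
    have := norm_sub_le (I₁ + 2 * Real.pi * Complex.I * z * I₂) I₁
    rw [add_sub_cancel_left] at this
    rw [add_div]
    linarith
  have h3 : ‖2 * Real.pi * Complex.I * z * I₂‖ = 2 * Real.pi * |z| * ‖I₂‖ := by
    simp [abs_of_pos Real.pi_pos]
  have hz' : 0 < |z| := abs_pos.2 hz
  rw [mul_comm |z|, ← div_div, le_div_iff₀ hz']
  rw [h3] at h2
  refine le_trans ?_ h2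
  have := Real.pi_gt_three
  nlinarith [mul_nonneg hz'.le (norm_nonneg I₂)]

theorem exists_norm_integral_compl_le {n : ℕ} {f g : MvPolynomial (Fin n) ℝ} (hf : f ≠ 0)
    (hg : g ≠ 0) (hfg : ∀ c : ℝ, f ≠ c • g)
    {Φ : (Fin n → ℝ) → ℂ} (hΦ : ContDiff ℝ (⊤ : ℕ∞) Φ) (hΦc : HasCompactSupport Φ) :
    ∃ δ C : ℝ, 0 < δ ∧ 0 ≤ C ∧ ∀ z ε : ℝ, z ≠ 0 → 0 < ε → ε ≤ 1 →
      ‖∫ x in {x | eval x f = 0 ∨ eval x g = 0}ᶜ, Φ x * Complex.exp (2 * Real.pi * Complex.I *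
        ((z * (eval x f / eval x g) : ℝ) : ℂ))‖ ≤ C / (|z| * ε ^ 2) + C * ε ^ δ := by
  obtain ⟨i, hi⟩ := exists_pderiv_wronskian_ne_zero hg hfg
  obtain ⟨C₁, hC₁, h₁⟩ := exists_norm_integral_mul_rationalPhase_le (f := f) (g := g) (i := i)
    hΦ hΦc
  obtain ⟨δ₂, C₂, hδ₂, hC₂, h₂⟩ := exists_integral_norm_mul_regularized_le_rpow hΦ.continuous hΦc hi
  obtain ⟨δ₃, C₃, hδ₃, hC₃, h₃⟩ := exists_integral_norm_mul_regularized_le_rpow hΦ.continuous hΦc hf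
  refine ⟨min δ₂ δ₃, C₁ + C₂ + C₃, by positivity, by positivity, fun z ε hz hε hε1 => ?_⟩
  specialize h₁ z ε hz hε hε1
  specialize h₂ ε hε hε1
  specialize h₃ ε hε hε1
  set P := g * pderiv i f - f * pderiv i g with hP
  have hΦcont := hΦ.continuous
  have hum := measurable_rationalPhase f g z
  have hu1 := norm_rationalPhase_le_one f g z
  have hreg : ∀ r : MvPolynomial (Fin n) ℝ,
      Integrable fun x => ‖Φ x‖ * (ε ^ 2 / (eval x r ^ 2 + ε ^ 2)) := by
    intro r
    have hr : Continuous fun x : Fin n → ℝ => eval x r := continuous_eval r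
    have hden : ∀ x : Fin n → ℝ, eval x r ^ 2 + ε ^ 2 ≠ 0 := fun x => by positivity
    exact Continuous.integrable_of_hasCompactSupport (by fun_prop (disch := assumption))
      hΦc.norm.mul_right
  set D : Set (Fin n → ℝ) := {x | eval x f = 0 ∨ eval x g = 0} with hD
  have hDm : MeasurableSet D :=
    (((continuous_eval f).measurable) (measurableSet_singleton 0)).union
      (((continuous_eval g).measurable) (measurableSet_singleton 0))
  set A : (Fin n → ℝ) → ℂ := Dᶜ.indicator fun x => Φ x * Complex.exp (2 * Real.pi * Complex.I *
    ((z * (eval x f / eval x g) : ℝ) : ℂ)) with hA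
  set B : (Fin n → ℝ) → ℂ := fun x => Φ x * ((eval x P ^ 2 /
    (eval x P ^ 2 + ε ^ 2) : ℝ) : ℂ) * rationalPhase f g z x with hB
  have hΦu : Integrable fun x => Φ x * rationalPhase f g z x :=
    (hΦcont.integrable_of_hasCompactSupport hΦc).mul_bdd hum.aestronglyMeasurable
      (Filter.Eventually.of_forall hu1)
  have hAeq : A = Dᶜ.indicator fun x => Φ x * rationalPhase f g z x := by
    refine Set.indicator_congr fun x hx => ?_
    simp only [hD, Set.mem_compl_iff, Set.mem_ofPred_eq, not_or] at hx
    simp only [rationalPhase, if_neg hx.2]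
  have hAi : Integrable A := hAeq ▸ hΦu.indicator hDm.compl
  have hBi : Integrable B := by
    have hPc : Continuous fun x : Fin n → ℝ => eval x P := continuous_eval P
    have hden : ∀ x : Fin n → ℝ, eval x P ^ 2 + ε ^ 2 ≠ 0 := fun x => by positivity
    exact (Continuous.integrable_of_hasCompactSupport (by fun_prop (disch := assumption))
      hΦc.mul_right).mul_bdd hum.aestronglyMeasurable (Filter.Eventually.of_forall hu1)
  have hpt : ∀ x, ‖A x - B x‖ ≤ ‖Φ x‖ * (ε ^ 2 / (eval x P ^ 2 + ε ^ 2)) +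
      ‖Φ x‖ * (ε ^ 2 / (eval x f ^ 2 + ε ^ 2)) := by
    intro x
    have hfrac : eval x P ^ 2 / (eval x P ^ 2 + ε ^ 2) = 1 - ε ^ 2 / (eval x P ^ 2 + ε ^ 2) := by
      field_simp
      ring
    have hfrac1 : ε ^ 2 / (eval x P ^ 2 + ε ^ 2) ≤ 1 :=
      (div_le_one (by positivity)).2 (by nlinarith [sq_nonneg (eval x P)])
    have hfrac0 : 0 ≤ ε ^ 2 / (eval x P ^ 2 + ε ^ 2) := by positivity
    by_cases hx : x ∈ D
    · have hAx : A x = 0 := Set.indicator_of_notMem (by simpa using hx) _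
      rw [hAx, zero_sub, norm_neg]
      rcases hx with hx | hx
      · have h1 : ε ^ 2 / (eval x f ^ 2 + ε ^ 2) = 1 := by
          rw [hx]; field_simp; ring
        have h2 : ‖B x‖ ≤ ‖Φ x‖ := by
          simp only [hB, norm_mul, Complex.norm_real, hfrac]
          rw [mul_assoc]
          refine mul_le_of_le_one_right (norm_nonneg _) (mul_le_one₀ ?_ (norm_nonneg _) (hu1 x))
          exact abs_le.2 ⟨by linarith, by linarith⟩
        rw [h1, mul_one]
        have : 0 ≤ ‖Φ x‖ * (ε ^ 2 / (eval x P ^ 2 + ε ^ 2)) := by positivity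
        linarith
      · have : B x = 0 := by simp [hB, rationalPhase, hx]
        rw [this, norm_zero]
        positivity
    · have hAx : A x = Φ x * rationalPhase f g z x := by
        rw [hAeq]; exact Set.indicator_of_mem (by simpa using hx) _
      have : A x - B x = Φ x * ((ε ^ 2 / (eval x P ^ 2 + ε ^ 2) : ℝ) : ℂ) *
          rationalPhase f g z x := by
        rw [hAx]; simp only [hB, hfrac]; push_cast; ring
      rw [this, norm_mul]
      refine (mul_le_of_le_one_right (norm_nonneg _) (hu1 x)).trans ?_
      rw [norm_mul, Complex.norm_real, Real.norm_of_nonneg hfrac0]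
      exact le_add_of_nonneg_right (by positivity)
  rw [← integral_indicator hDm.compl]
  calc ‖∫ x, A x‖ = ‖(∫ x, A x - B x) + ∫ x, B x‖ := by
        rw [integral_sub hAi hBi, sub_add_cancel]
    _ ≤ ‖∫ x, A x - B x‖ + ‖∫ x, B x‖ := norm_add_le _ _
    _ ≤ (C₂ * ε ^ δ₂ + C₃ * ε ^ δ₃) + C₁ / (|z| * ε ^ 2) := by
        refine add_le_add ?_ h₁
        refine (norm_integral_le_of_norm_le ((hreg P).add (hreg f))
          (Filter.Eventually.of_forall hpt)).trans ?_
        rw [integral_add' (hreg P) (hreg f)]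
        exact add_le_add h₂ h₃
    _ ≤ (C₂ * ε ^ min δ₂ δ₃ + C₃ * ε ^ min δ₂ δ₃) + C₁ / (|z| * ε ^ 2) := by
        gcongr ?_ * ?_ + ?_ * ?_ + _
        · exact Real.rpow_le_rpow_of_exponent_ge hε hε1 (min_le_left _ _)
        · exact Real.rpow_le_rpow_of_exponent_ge hε hε1 (min_le_right _ _)
    _ ≤ _ := by
        have h1 : 0 ≤ C₁ * ε ^ min δ₂ δ₃ := by positivity
        have h2 : C₁ / (|z| * ε ^ 2) ≤ (C₁ + C₂ + C₃) / (|z| * ε ^ 2) := by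
          gcongr
          linarith
        linarith

/-- Estimate for the real oscillatory integral `E_Φ(z; f/g)` at infinity:
`|E_Φ(z)| ≤ C·|z|^β·(ln|z|)^{m−1}` with `β < 0`. -/
theorem real_oscillatory_integral_estimate_large_z
    (n : ℕ)
    (f g : MvPolynomial (Fin n) ℝ) (hf : f ≠ 0) (hg : g ≠ 0)
    (hfg : ∀ c : ℝ, f ≠ c • g)
    (Φ : (Fin n → ℝ) → ℂ) (hΦsmooth : ContDiff ℝ (⊤ : ℕ∞) Φ) (hΦc : HasCompactSupport Φ)
    (D : Set (Fin n → ℝ))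
    (hD : D = {x | eval x f = 0 ∨ eval x g = 0})
    (E : ℝ → ℂ)
    (hE : ∀ z : ℝ, E z = ∫ x in Dᶜ,
      Φ x * Complex.exp (2 * Real.pi * Complex.I *
        ((z * (eval x f / eval x g) : ℝ) : ℂ))) :
    ∃ (β : ℝ) (m : ℕ) (C : ℝ), β < 0 ∧ 1 ≤ m ∧ 0 < C ∧
      ∀ z : ℝ, 2 ≤ |z| →
        ‖E z‖ ≤ C * |z| ^ β * (Real.log |z|) ^ (m - 1) := by
  obtain ⟨δ, C, hδ, hC, h⟩ := exists_norm_integral_compl_le hf hg hfg hΦsmooth hΦc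
  refine ⟨-min (1 / 2) (δ / 4), 1, 2 * C + 1, neg_neg_of_pos (by positivity), le_rfl,
    by positivity, fun z hz => ?_⟩
  have hz1 : 1 ≤ |z| := by linarith
  have hz0 : 0 < |z| := by linarith
  have hε : 0 < |z| ^ (-(1 / 4) : ℝ) := Real.rpow_pos_of_pos hz0 _
  have hε1 : |z| ^ (-(1 / 4) : ℝ) ≤ 1 := Real.rpow_le_one_of_one_le_of_nonpos hz1 (by norm_num)
  have key := h z _ (abs_pos.1 hz0) hε hε1
  have e1 : C / (|z| * (|z| ^ (-(1 / 4) : ℝ)) ^ 2) = C * |z| ^ (-(1 / 2) : ℝ) := by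
    rw [div_eq_mul_inv, ← Real.rpow_natCast, ← Real.rpow_mul hz0.le]
    nth_rewrite 1 [← Real.rpow_one |z|]
    rw [← Real.rpow_add hz0, ← Real.rpow_neg hz0.le]
    norm_num
  have e2 : (|z| ^ (-(1 / 4) : ℝ)) ^ δ = |z| ^ (-(δ / 4)) := by
    rw [← Real.rpow_mul hz0.le]; congr 1; ring
  have h1 : |z| ^ (-(1 / 2) : ℝ) ≤ |z| ^ (-min (1 / 2) (δ / 4)) :=
    Real.rpow_le_rpow_of_exponent_le hz1 (neg_le_neg (min_le_left _ _))
  have h2 : |z| ^ (-(δ / 4)) ≤ |z| ^ (-min (1 / 2) (δ / 4)) :=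
    Real.rpow_le_rpow_of_exponent_le hz1 (neg_le_neg (min_le_right _ _))
  rw [e1, e2] at key
  rw [hE, hD, Nat.sub_self, pow_zero, mul_one]
  have h3 : 0 ≤ |z| ^ (-min (1 / 2) (δ / 4)) := by positivity
  linarith [mul_le_mul_of_nonneg_left h1 hC, mul_le_mul_of_nonneg_left h2 hC]
end

section
/- Let p be a prime with p ≡ 3 (mod 4). Then for every s ∈ ℂ with Re(s) < 1, the function (x, y) ↦ |(x² + y²)/(x⁴ + y⁴)|_p^s is integrable on (pℤ_p)² ∖ {(0,0)}, and ∫_{(pℤ_p)² ∖ {(0,0)}} |(x² + y²)/(x⁴ + y⁴)|_p^s dμ(x, y) = (p² − 1)/(p²·(p^{2−2s} − 1)). -/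
open MeasureTheory Complex

/-- If `-1` is not a square modulo `p`, the form `x² + y²` is anisotropic over `ℚ_p`. -/
lemma Padic.norm_sq_add_sq (p : ℕ) [Fact p.Prime] (hp : p % 4 = 3) (x y : ℚ_[p]) :
    ‖x ^ 2 + y ^ 2‖ = max ‖x‖ ‖y‖ ^ 2 := by
  by_cases h : ‖x‖ = ‖y‖
  · rcases eq_or_ne x 0 with rfl | hx
    · have : y = 0 := by simpa using h.symm
      simp [this]
    · have hx' : ‖x‖ ≠ 0 := norm_ne_zero_iff.2 hx
      have hu : ‖y / x‖ ≤ 1 := by rw [norm_div, ← h, div_self hx']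
      let u : ℤ_[p] := ⟨y / x, hu⟩
      have h1 : ‖1 + u ^ 2‖ = 1 := by
        refine le_antisymm (PadicInt.norm_le_one _) (not_lt.1 fun hlt => ?_)
        have h0 := (PadicInt.norm_lt_one_iff_dvd _).1 hlt
        rw [← Ideal.mem_span_singleton, ← PadicInt.maximalIdeal_eq_span_p,
          ← PadicInt.ker_toZMod, RingHom.mem_ker, map_add, map_one, map_pow] at h0
        refine ZMod.exists_sq_eq_neg_one_iff.1 ⟨PadicInt.toZMod u, ?_⟩ hp
        linear_combination -h0
      have h2 : x ^ 2 + y ^ 2 = x ^ 2 * (1 + (y / x) ^ 2) := by field_simp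
      have h3 : ‖1 + (y / x) ^ 2‖ = 1 := by
        rwa [PadicInt.norm_def, PadicInt.coe_add, PadicInt.coe_one, PadicInt.coe_pow] at h1
      rw [h2, norm_mul, h3, ← h, max_self, norm_pow, mul_one]
  · have h' : ‖x ^ 2‖ ≠ ‖y ^ 2‖ := by
      simpa [norm_pow, sq_eq_sq₀] using h
    rw [Padic.add_eq_max_of_ne h', norm_pow, norm_pow]
    rcases le_total ‖x‖ ‖y‖ with hle | hle
    · rw [max_eq_right hle, max_eq_right (by gcongr)]
    · rw [max_eq_left hle, max_eq_left (by gcongr)]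

lemma Padic.norm_div_forms (p : ℕ) [Fact p.Prime] (hp : p % 4 = 3) (z : ℚ_[p] × ℚ_[p]) :
    ‖(z.1 ^ 2 + z.2 ^ 2) / (z.1 ^ 4 + z.2 ^ 4)‖ = (‖z‖ ^ 2)⁻¹ := by
  have h4 : z.1 ^ 4 + z.2 ^ 4 = (z.1 ^ 2) ^ 2 + (z.2 ^ 2) ^ 2 := by ring
  have hmax : max ‖z.1 ^ 2‖ ‖z.2 ^ 2‖ = ‖z‖ ^ 2 := by
    rw [norm_pow, norm_pow, Prod.norm_def]
    rcases le_total ‖z.1‖ ‖z.2‖ with hle | hle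
    · rw [max_eq_right hle, max_eq_right (by gcongr)]
    · rw [max_eq_left hle, max_eq_left (by gcongr)]
  rw [h4, norm_div, norm_sq_add_sq p hp, norm_sq_add_sq p hp, hmax, ← Prod.norm_def]
  rcases eq_or_ne ‖z‖ 0 with h | h
  · simp [h]
  · field_simp

lemma Padic.exists_norm_sub_natCast_le {p : ℕ} [Fact p.Prime] (k : ℕ) {x : ℚ_[p]}
    (hx : ‖x‖ ≤ (p : ℝ)⁻¹ ^ k) :
    ∃ a : Fin p, ‖x - (p : ℚ_[p]) ^ k * ((a : ℕ) : ℚ_[p])‖ ≤ (p : ℝ)⁻¹ ^ (k + 1) := by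
  have hp0 : (0 : ℝ) < p := mod_cast (Fact.out : p.Prime).pos
  have hpne : (p : ℚ_[p]) ≠ 0 := mod_cast (Fact.out : p.Prime).ne_zero
  have hu : ‖x / (p : ℚ_[p]) ^ k‖ ≤ 1 := by
    rw [norm_div, norm_pow, Padic.norm_p]
    exact div_le_one_of_le₀ hx (by positivity)
  let u : ℤ_[p] := ⟨x / (p : ℚ_[p]) ^ k, hu⟩
  obtain ⟨n, hn, hmem⟩ := PadicInt.exists_mem_range u
  refine ⟨⟨n, hn⟩, ?_⟩
  rw [PadicInt.maximalIdeal_eq_span_p, ← pow_one (p : ℤ_[p]),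
    ← PadicInt.norm_le_pow_iff_mem_span_pow] at hmem
  have h1 : ‖x / (p : ℚ_[p]) ^ k - n‖ ≤ (p : ℝ)⁻¹ := by
    rw [PadicInt.norm_def, PadicInt.coe_sub, PadicInt.coe_natCast] at hmem
    simpa only [zpow_neg_one, Nat.cast_one] using hmem
  have h2 : x - (p : ℚ_[p]) ^ k * (n : ℚ_[p]) =
      (p : ℚ_[p]) ^ k * (x / (p : ℚ_[p]) ^ k - n) := by field_simp
  rw [h2, norm_mul, norm_pow, Padic.norm_p, pow_succ]
  gcongr

lemma Padic.eq_of_norm_mul_natCast_sub_le {p : ℕ} [Fact p.Prime] (k : ℕ) {a b : Fin p}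
    (h : ‖(p : ℚ_[p]) ^ k * ((a : ℕ) : ℚ_[p]) - (p : ℚ_[p]) ^ k * ((b : ℕ) : ℚ_[p])‖
      ≤ (p : ℝ)⁻¹ ^ (k + 1)) : a = b := by
  have hp0 : (0 : ℝ) < p := mod_cast (Fact.out : p.Prime).pos
  have hp1 : (1 : ℝ) < p := mod_cast (Fact.out : p.Prime).one_lt
  rw [← mul_sub, norm_mul, norm_pow, Padic.norm_p, pow_succ] at h
  have h1 := le_of_mul_le_mul_left h (by positivity)
  have h2 : ‖(((a : ℤ) - (b : ℤ) : ℤ) : ℚ_[p])‖ < 1 := by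
    push_cast
    exact h1.trans_lt (inv_lt_one_of_one_lt₀ hp1)
  rw [Padic.norm_intCast_lt_one_iff] at h2
  have h3 := Int.eq_zero_of_abs_lt_dvd h2 (by rw [abs_lt]; omega)
  ext
  omega

section Measure

variable {p : ℕ} [Fact p.Prime] [MeasurableSpace (ℚ_[p] × ℚ_[p])] [BorelSpace (ℚ_[p] × ℚ_[p])]
  (μ : Measure (ℚ_[p] × ℚ_[p])) [μ.IsAddHaarMeasure]

lemma Padic.measure_closedBall_succ (k : ℕ) :
    μ (Metric.closedBall 0 ((p : ℝ)⁻¹ ^ k)) =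
      (p : ENNReal) ^ 2 * μ (Metric.closedBall 0 ((p : ℝ)⁻¹ ^ (k + 1))) := by
  have hp1 : (1 : ℝ) < p := mod_cast (Fact.out : p.Prime).one_lt
  have hr : (p : ℝ)⁻¹ ^ (k + 1) ≤ (p : ℝ)⁻¹ ^ k :=
    pow_le_pow_of_le_one (by positivity) (inv_le_one_of_one_le₀ hp1.le) (by omega)
  let c : Fin p × Fin p → ℚ_[p] × ℚ_[p] := fun a =>
    ((p : ℚ_[p]) ^ k * ((a.1 : ℕ) : ℚ_[p]), (p : ℚ_[p]) ^ k * ((a.2 : ℕ) : ℚ_[p]))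
  have hc (n : Fin p) : ‖(p : ℚ_[p]) ^ k * ((n : ℕ) : ℚ_[p])‖ ≤ (p : ℝ)⁻¹ ^ k := by
    rw [norm_mul, norm_pow, Padic.norm_p]
    exact mul_le_of_le_one_right (by positivity)
      (by simpa using Padic.norm_int_le_one (p := p) (n : ℕ))
  have hcover : Metric.closedBall (0 : ℚ_[p] × ℚ_[p]) ((p : ℝ)⁻¹ ^ k) =
      ⋃ a, Metric.closedBall (c a) ((p : ℝ)⁻¹ ^ (k + 1)) := by
    ext z
    simp only [mem_closedBall_iff_norm, Set.mem_iUnion, sub_zero]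
    constructor
    · intro hz
      obtain ⟨a, ha⟩ := Padic.exists_norm_sub_natCast_le k ((norm_fst_le z).trans hz)
      obtain ⟨b, hb⟩ := Padic.exists_norm_sub_natCast_le k ((norm_snd_le z).trans hz)
      exact ⟨(a, b), norm_prod_le_iff.2 ⟨ha, hb⟩⟩
    · rintro ⟨a, ha⟩
      have ha' := norm_prod_le_iff.1 ha
      refine norm_prod_le_iff.2 ⟨?_, ?_⟩
      · rw [← sub_add_cancel z.1 (c a).1]
        exact (Padic.nonarchimedean _ _).trans (max_le (ha'.1.trans hr) (hc _))
      · rw [← sub_add_cancel z.2 (c a).2]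
        exact (Padic.nonarchimedean _ _).trans (max_le (ha'.2.trans hr) (hc _))
  have hdisj : Pairwise (Function.onFun Disjoint
      fun a => Metric.closedBall (c a) ((p : ℝ)⁻¹ ^ (k + 1))) := by
    intro a b hab
    refine Set.disjoint_left.2 fun z hza hzb => hab ?_
    rw [mem_closedBall_iff_norm', norm_prod_le_iff] at hza
    rw [mem_closedBall_iff_norm, norm_prod_le_iff] at hzb
    refine Prod.ext (Padic.eq_of_norm_mul_natCast_sub_le k ?_)
      (Padic.eq_of_norm_mul_natCast_sub_le k ?_)
    · have := (Padic.nonarchimedean _ _).trans (max_le hza.1 hzb.1)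
      simpa [c] using this
    · have := (Padic.nonarchimedean _ _).trans (max_le hza.2 hzb.2)
      simpa [c] using this
  rw [hcover, measure_iUnion hdisj fun _ => Metric.isClosed_closedBall.measurableSet,
    tsum_fintype]
  simp only [Measure.addHaar_closedBall_center, Finset.sum_const, Finset.card_univ,
    Fintype.card_prod, Fintype.card_fin, nsmul_eq_mul]
  push_cast
  ring

lemma Padic.measureReal_closedBall (hμ : μ (Metric.closedBall 0 1) = 1) (k : ℕ) :
    μ.real (Metric.closedBall 0 ((p : ℝ)⁻¹ ^ k)) = ((p : ℝ) ^ 2)⁻¹ ^ k := by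
  have hp0 : (p : ℝ) ≠ 0 := mod_cast (Fact.out : p.Prime).ne_zero
  induction k with
  | zero => simp [measureReal_def, hμ]
  | succ k ih =>
    rw [measureReal_def, Padic.measure_closedBall_succ, ENNReal.toReal_mul,
      ← measureReal_def] at ih
    rw [pow_succ ((p : ℝ) ^ 2)⁻¹, ← ih]
    simp only [ENNReal.toReal_pow, ENNReal.toReal_natCast]
    field_simp

lemma Padic.measureReal_sphere (hμ : μ (Metric.closedBall 0 1) = 1) (k : ℕ) :
    μ.real (Metric.sphere 0 ((p : ℝ)⁻¹ ^ k)) =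
      ((p : ℝ) ^ 2)⁻¹ ^ k * (1 - ((p : ℝ) ^ 2)⁻¹) := by
  have hp1 : (1 : ℝ) < p := mod_cast (Fact.out : p.Prime).one_lt
  have hp0 : (0 : ℝ) < p := by positivity
  have hlt : (p : ℝ)⁻¹ ^ (k + 1) < (p : ℝ)⁻¹ ^ k :=
    pow_lt_pow_right_of_lt_one₀ (by positivity) (inv_lt_one_of_one_lt₀ hp1) (by omega)
  have hS : Metric.sphere (0 : ℚ_[p] × ℚ_[p]) ((p : ℝ)⁻¹ ^ k) =
      Metric.closedBall 0 ((p : ℝ)⁻¹ ^ k) \ Metric.closedBall 0 ((p : ℝ)⁻¹ ^ (k + 1)) := by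
    have key (x : ℚ_[p]) (hx : ‖x‖ < (p : ℝ)⁻¹ ^ k) : ‖x‖ ≤ (p : ℝ)⁻¹ ^ (k + 1) := by
      have := (Padic.norm_le_pow_iff_norm_lt_pow_add_one x (-(k + 1 : ℤ))).2 (by
        simpa [zpow_neg] using hx)
      have h2 : (p : ℝ) ^ (-(k + 1 : ℤ)) = (p : ℝ)⁻¹ ^ (k + 1) := by
        rw [zpow_neg, inv_pow]; norm_cast
      rwa [h2] at this
    ext z
    simp only [mem_sphere_zero_iff_norm, Set.mem_sdiff, mem_closedBall_zero_iff, not_le]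
    refine ⟨fun h => ⟨h.le, h ▸ hlt⟩, fun ⟨h1, h2⟩ => h1.antisymm (not_lt.1 fun h3 => ?_)⟩
    exact absurd (norm_prod_le_iff.2 ⟨key z.1 ((norm_fst_le z).trans_lt h3),
      key z.2 ((norm_snd_le z).trans_lt h3)⟩) (not_le.2 h2)
  rw [hS, measureReal_sdiff (Metric.closedBall_subset_closedBall hlt.le)
    Metric.isClosed_closedBall.measurableSet
    (isCompact_closedBall _ _).measure_lt_top.ne, measureReal_closedBall μ hμ,
    measureReal_closedBall μ hμ]
  ring

end Measure

lemma Padic.punctured_ball_eq_iUnion_sphere (p : ℕ) [Fact p.Prime] :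
    ({z : ℚ_[p] × ℚ_[p] | ‖z.1‖ ≤ (p : ℝ)⁻¹ ∧ ‖z.2‖ ≤ (p : ℝ)⁻¹} \ {(0, 0)}) =
      ⋃ k : ℕ, Metric.sphere (0 : ℚ_[p] × ℚ_[p]) ((p : ℝ)⁻¹ ^ (k + 1)) := by
  have hp1 : (1 : ℝ) < p := mod_cast (Fact.out : p.Prime).one_lt
  have hp0 : (0 : ℝ) < p := by positivity
  ext z
  simp only [Set.mem_sdiff, Set.mem_ofPred_eq, Set.mem_singleton_iff, Set.mem_iUnion,
    mem_sphere_zero_iff_norm, ← norm_prod_le_iff]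
  constructor
  · rintro ⟨hz, h0⟩
    have hz0 : ‖z‖ ≠ 0 := norm_ne_zero_iff.2 h0
    have hval : ∃ n : ℤ, ‖z‖ = (p : ℝ) ^ (-n) := by
      rcases max_choice ‖z.1‖ ‖z.2‖ with h | h <;> rw [← Prod.norm_def] at h <;>
        rw [h] at hz0 ⊢ <;>
        exact ⟨_, Padic.norm_eq_zpow_neg_valuation (norm_ne_zero_iff.1 hz0)⟩
    obtain ⟨n, hn⟩ := hval
    have hn1 : 1 ≤ n := by
      rw [hn, ← zpow_neg_one, zpow_le_zpow_iff_right₀ hp1] at hz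
      omega
    refine ⟨(n - 1).toNat, ?_⟩
    rw [hn, zpow_neg, inv_pow, ← zpow_natCast]
    congr 2
    omega
  · rintro ⟨k, hk⟩
    refine ⟨?_, ?_⟩
    · rw [hk]
      exact pow_le_of_le_one (by positivity) (inv_le_one_of_one_le₀ hp1.le) (by omega)
    · rintro rfl
      have hpos : (0 : ℝ) < (p : ℝ)⁻¹ ^ (k + 1) := by positivity
      exact hpos.ne (norm_zero.symm.trans hk)

lemma Complex.ofReal_pow_cpow {x : ℝ} (hx : 0 ≤ x) (n : ℕ) (s : ℂ) :
    ((x ^ n : ℝ) : ℂ) ^ s = ((x : ℂ) ^ s) ^ n := by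
  induction n with
  | zero => simp
  | succ n ih => rw [pow_succ, ofReal_mul, mul_cpow_ofReal_nonneg (by positivity) hx, ih, pow_succ]

/-- Explicit local zeta function of `(x²+y²)/(x⁴+y⁴)` on `(pℤ_p)²`, for `p ≡ 3 (mod 4)`. -/
theorem padic_zeta_example_two
    (p : ℕ) [Fact p.Prime] (hp : p % 4 = 3)
    [MeasurableSpace (ℚ_[p] × ℚ_[p])] [BorelSpace (ℚ_[p] × ℚ_[p])]
    (μ : Measure (ℚ_[p] × ℚ_[p])) [μ.IsAddHaarMeasure]
    (hμ : μ {z : ℚ_[p] × ℚ_[p] | ‖z.1‖ ≤ 1 ∧ ‖z.2‖ ≤ 1} = 1) :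
    ∀ s : ℂ, s.re < 1 →
      IntegrableOn
        (fun z : ℚ_[p] × ℚ_[p] =>
          ((‖(z.1 ^ 2 + z.2 ^ 2) / (z.1 ^ 4 + z.2 ^ 4)‖ : ℝ) : ℂ) ^ s)
        ({z : ℚ_[p] × ℚ_[p] | ‖z.1‖ ≤ (p : ℝ)⁻¹ ∧ ‖z.2‖ ≤ (p : ℝ)⁻¹} \ {(0, 0)}) μ ∧
      ∫ z in ({z : ℚ_[p] × ℚ_[p] | ‖z.1‖ ≤ (p : ℝ)⁻¹ ∧ ‖z.2‖ ≤ (p : ℝ)⁻¹} \ {(0, 0)}),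
          ((‖(z.1 ^ 2 + z.2 ^ 2) / (z.1 ^ 4 + z.2 ^ 4)‖ : ℝ) : ℂ) ^ s ∂μ =
        ((p : ℂ) ^ 2 - 1) / ((p : ℂ) ^ 2 * ((p : ℂ) ^ ((2 : ℂ) - 2 * s) - 1)) := by
  intro s hs
  have hp1 : (1 : ℝ) < p := mod_cast (Fact.out : p.Prime).one_lt
  have hp0 : (0 : ℝ) < p := by positivity
  have hpc : (p : ℂ) ≠ 0 := mod_cast (Fact.out : p.Prime).ne_zero
  have hball : μ (Metric.closedBall 0 1) = 1 := by
    rw [← hμ]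
    congr 1
    ext z
    simp [← norm_prod_le_iff]
  rw [Padic.punctured_ball_eq_iUnion_sphere]
  set f : ℚ_[p] × ℚ_[p] → ℂ := fun z =>
    ((‖(z.1 ^ 2 + z.2 ^ 2) / (z.1 ^ 4 + z.2 ^ 4)‖ : ℝ) : ℂ) ^ s with hf
  set S : ℕ → Set (ℚ_[p] × ℚ_[p]) := fun k => Metric.sphere 0 ((p : ℝ)⁻¹ ^ (k + 1))
  set w : ℂ := (((p : ℝ) ^ 2 : ℝ) : ℂ) ^ s with hw
  set q : ℝ := (p : ℝ) ^ 2 with hq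
  have hq1 : 1 < q := one_lt_pow₀ hp1 (by norm_num)
  have hq0 : 0 < q := by positivity
  have hqc : (q : ℂ) ≠ 0 := mod_cast hq0.ne'
  have hwn : ‖w‖ < q := by
    rw [hw, norm_cpow_eq_rpow_re_of_pos hq0]
    simpa using Real.rpow_lt_rpow_of_exponent_lt hq1 hs
  have hw0 : w ≠ 0 := by
    rw [hw, Ne, cpow_eq_zero_iff]
    exact fun h => hqc h.1
  have hfS (k : ℕ) : ∀ z ∈ S k, f z = w ^ (k + 1) := by
    intro z hz
    have hz' : ‖z‖ = (p : ℝ)⁻¹ ^ (k + 1) := mem_sphere_zero_iff_norm.1 hz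
    have : (‖z‖ ^ 2)⁻¹ = q ^ (k + 1) := by
      rw [hz', hq]
      simp only [inv_pow, inv_inv]
      ring
    simp only [hf]
    rw [Padic.norm_div_forms p hp, this, ofReal_pow_cpow hq0.le]
  have hSm (k : ℕ) : MeasurableSet (S k) := Metric.isClosed_sphere.measurableSet
  have hSfin (k : ℕ) : μ (S k) ≠ ⊤ := (isCompact_sphere _ _).measure_lt_top.ne
  have hSreal (k : ℕ) : μ.real (S k) = q⁻¹ ^ (k + 1) * (1 - q⁻¹) :=
    Padic.measureReal_sphere μ hball (k + 1)
  have hfi (k : ℕ) : IntegrableOn f (S k) μ :=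
    (integrableOn_congr_fun (hfS k) (hSm k)).2 (integrableOn_const (hSfin k))
  have hdisj : Pairwise (Function.onFun Disjoint S) := by
    intro a b hab
    refine Set.disjoint_left.2 fun z hza hzb => hab ?_
    have h := (mem_sphere_zero_iff_norm.1 hza).symm.trans (mem_sphere_zero_iff_norm.1 hzb)
    have := pow_right_injective₀ (inv_pos.2 hp0) (inv_lt_one_of_one_lt₀ hp1).ne h
    omega
  have hr : ‖w / q‖ < 1 := by
    rw [norm_div, norm_real, Real.norm_of_nonneg hq0.le]
    exact (div_lt_one hq0).2 hwn
  have hint (k : ℕ) : ∫ z in S k, f z ∂μ = (w / q) ^ k * ((w / q) * (1 - (q : ℂ)⁻¹)) := by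
    rw [setIntegral_congr_fun (hSm k) (hfS k), setIntegral_const, hSreal, real_smul]
    push_cast
    rw [div_eq_mul_inv]
    ring
  have hintn (k : ℕ) : ∫ z in S k, ‖f z‖ ∂μ = ‖w / q‖ ^ k * (‖w / q‖ * (1 - q⁻¹)) := by
    rw [setIntegral_congr_fun (g := fun _ => ‖w ^ (k + 1)‖) (hSm k)
      (fun z hz => congrArg norm (hfS k z hz)), setIntegral_const, hSreal,
      norm_div, norm_real, Real.norm_of_nonneg hq0.le, norm_pow, smul_eq_mul, div_eq_mul_inv]
    ring
  have hInt : IntegrableOn f (⋃ k, S k) μ := by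
    refine integrableOn_iUnion_of_summable_integral_norm hfi ?_
    simp only [hintn]
    exact (summable_geometric_of_lt_one (norm_nonneg _) hr).mul_right _
  refine ⟨hInt, ?_⟩
  have h1 := hasSum_integral_iUnion hSm hdisj hInt
  simp only [hint] at h1
  rw [h1.unique ((hasSum_geometric_of_norm_lt_one hr).mul_right _)]
  have hqp : (q : ℂ) = (p : ℂ) ^ 2 := by simp [hq]
  have hpow : (p : ℂ) ^ ((2 : ℂ) - 2 * s) = q / w := by
    have h2 : (p : ℂ) ^ (2 * s) = w := by
      rw [hw, show ((p : ℂ)) = ((p : ℝ) : ℂ) by simp, ofReal_pow_cpow hp0.le]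
      exact_mod_cast cpow_nat_mul _ 2 s
    rw [cpow_sub _ _ hpc, h2, hqp]
    norm_cast
  have hwq : (q : ℂ) - w ≠ 0 := by
    intro h
    rw [← sub_eq_zero.1 h, norm_real, Real.norm_of_nonneg hq0.le] at hwn
    exact lt_irrefl _ hwn
  have hden : 1 - w / q ≠ 0 := by
    rw [one_sub_div hqc]
    exact div_ne_zero hwq hqc
  have hden' : (q : ℂ) / w - 1 ≠ 0 := by
    rw [div_sub_one hw0]
    exact div_ne_zero hwq hw0
  rw [hpow, ← hqp]
  field_simp
end

section
/- Let p be a prime with p ≡ 3 (mod 4). Then for every s ∈ ℂ with −3/2 < Re(s) < 3/2, the function (x, y) ↦ |(y² + x⁴)/(x² + y⁴)|_p^s is integrable on (pℤ_p)² ∖ {(0,0)}, and ∫_{(pℤ_p)² ∖ {(0,0)}} |(y² + x⁴)/(x² + y⁴)|_p^s dμ(x, y) = (p − 1)·(p^{4+2s} + p^{4−2s} + p⁵ − p⁴ + p³ − p² − p − 1)/(p²·(p^{3+2s} − 1)·(p^{3−2s} − 1)). -/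
open MeasureTheory Complex

namespace PadicZeta

section Norm

variable {p : ℕ} [Fact p.Prime]

lemma norm_one_add_sq (hp : p % 4 = 3) {u : ℚ_[p]} (hu : ‖u‖ ≤ 1) : ‖1 + u ^ 2‖ = 1 := by
  let w : ℤ_[p] := ⟨u, hu⟩
  have hw : ‖1 + w ^ 2‖ = 1 := by
    by_contra h
    have hlt : ‖1 + w ^ 2‖ < 1 := lt_of_le_of_ne (PadicInt.norm_le_one _) h
    have hmem : 1 + w ^ 2 ∈ RingHom.ker (PadicInt.toZMod (p := p)) := by
      rw [PadicInt.ker_toZMod, IsLocalRing.mem_maximalIdeal]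
      exact PadicInt.mem_nonunits.2 hlt
    rw [RingHom.mem_ker, map_add, map_one, map_pow] at hmem
    exact ZMod.mod_four_ne_three_of_sq_eq_neg_one
      (eq_neg_of_add_eq_zero_right hmem) hp
  rw [PadicInt.norm_def] at hw
  push_cast at hw
  exact hw

/-- If `p ≡ 3 (mod 4)`, then `x² + y²` is anisotropic over `ℚ_[p]`, even modulo `p`. -/
lemma norm_sq_add_sq (hp : p % 4 = 3) (a b : ℚ_[p]) :
    ‖a ^ 2 + b ^ 2‖ = max ‖a‖ ‖b‖ ^ 2 := by
  wlog h : ‖b‖ ≤ ‖a‖ generalizing a b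
  · rw [add_comm, max_comm]
    exact this b a (le_of_not_ge h)
  rw [max_eq_left h]
  rcases eq_or_ne a 0 with rfl | ha
  · have hb : b = 0 := by simpa using h
    simp [hb]
  · have h1 : ‖b / a‖ ≤ 1 := by
      rw [norm_div]
      exact div_le_one_of_le₀ h (norm_nonneg _)
    have h2 : a ^ 2 + b ^ 2 = a ^ 2 * (1 + (b / a) ^ 2) := by
      field_simp
    rw [h2, norm_mul, norm_one_add_sq hp h1, norm_pow, mul_one]

variable (p) in
lemma inv_cast_pos : 0 < (p : ℝ)⁻¹ :=
  inv_pos.2 (Nat.cast_pos.2 (Fact.out : p.Prime).pos)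

variable (p) in
lemma inv_cast_lt_one : (p : ℝ)⁻¹ < 1 :=
  inv_lt_one_of_one_lt₀ (Nat.one_lt_cast.2 (Fact.out : p.Prime).one_lt)

lemma norm_lt_inv_pow_iff (x : ℚ_[p]) (m : ℕ) :
    ‖x‖ < (p : ℝ)⁻¹ ^ m ↔ ‖x‖ ≤ (p : ℝ)⁻¹ ^ (m + 1) := by
  have h := Padic.norm_le_pow_iff_norm_lt_pow_add_one x (-((m : ℤ) + 1))
  rw [neg_add_rev, neg_add_cancel_comm, zpow_neg, zpow_natCast, ← neg_add_rev, zpow_neg] at h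
  rw [inv_pow, inv_pow, ← h]
  norm_cast

lemma norm_eq_inv_pow_iff (x : ℚ_[p]) (m : ℕ) :
    ‖x‖ = (p : ℝ)⁻¹ ^ m ↔ ‖x‖ ≤ (p : ℝ)⁻¹ ^ m ∧ ¬ ‖x‖ ≤ (p : ℝ)⁻¹ ^ (m + 1) := by
  rw [← norm_lt_inv_pow_iff, not_lt]
  exact le_antisymm_iff

lemma exists_norm_eq_inv_pow {x : ℚ_[p]} (hx : x ≠ 0) (h : ‖x‖ ≤ (p : ℝ)⁻¹) :
    ∃ m : ℕ, ‖x‖ = (p : ℝ)⁻¹ ^ (m + 1) := by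
  obtain ⟨n, hn⟩ : ∃ n : ℕ, (p : ℝ)⁻¹ ^ n < ‖x‖ :=
    exists_pow_lt_of_lt_one (norm_pos_iff.2 hx) (inv_cast_lt_one p)
  induction n with
  | zero => exact absurd (hn.trans_le h) (by simpa using (inv_cast_lt_one p).le)
  | succ k ih =>
    by_cases hk : (p : ℝ)⁻¹ ^ k < ‖x‖
    · exact ih hk
    · rcases eq_or_lt_of_le (not_lt.1 hk) with h' | h'
      · rcases k with _ | k
        · exact absurd (h'.symm.trans_le h) (by simpa using inv_cast_lt_one p)
        · exact ⟨k, h'⟩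
      · exact absurd ((norm_lt_inv_pow_iff x k).1 h') (not_le.2 hn)

lemma inv_pow_injective : Function.Injective fun m : ℕ => (p : ℝ)⁻¹ ^ m :=
  pow_right_injective₀ (inv_cast_pos p) (inv_cast_lt_one p).ne

lemma norm_natCast_mul_pow (k m : ℕ) :
    ‖(k : ℚ_[p]) * (p : ℚ_[p]) ^ m‖ = ‖(k : ℚ_[p])‖ * (p : ℝ)⁻¹ ^ m := by
  rw [norm_mul, norm_pow, Padic.norm_p]

lemma norm_le_inv_pow_iff_exists (x : ℚ_[p]) (m : ℕ) :
    ‖x‖ ≤ (p : ℝ)⁻¹ ^ m ↔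
      ∃ k < p, ‖x - (k : ℚ_[p]) * (p : ℚ_[p]) ^ m‖ ≤ (p : ℝ)⁻¹ ^ (m + 1) := by
  have hq := inv_cast_pos p
  have hp0 : (p : ℚ_[p]) ≠ 0 := Nat.cast_ne_zero.2 (Fact.out : p.Prime).ne_zero
  constructor
  · intro h
    have h1 : ‖x / (p : ℚ_[p]) ^ m‖ ≤ 1 := by
      rw [norm_div, norm_pow, Padic.norm_p]
      exact div_le_one_of_le₀ h (pow_nonneg hq.le _)
    obtain ⟨k, hk, hmem⟩ := PadicInt.exists_mem_range (⟨_, h1⟩ : ℤ_[p])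
    refine ⟨k, hk, ?_⟩
    rw [IsLocalRing.mem_maximalIdeal, PadicInt.mem_nonunits, PadicInt.norm_def] at hmem
    have h2 : x - (k : ℚ_[p]) * (p : ℚ_[p]) ^ m
        = (x / (p : ℚ_[p]) ^ m - k) * (p : ℚ_[p]) ^ m := by
      field_simp
    rw [← norm_lt_inv_pow_iff, h2, norm_mul, norm_pow, Padic.norm_p]
    exact mul_lt_of_lt_one_left (pow_pos hq _) hmem
  · rintro ⟨k, -, hk⟩
    rw [← sub_add_cancel x ((k : ℚ_[p]) * (p : ℚ_[p]) ^ m)]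
    refine (Padic.nonarchimedean _ _).trans (max_le ?_ ?_)
    · exact ((norm_lt_inv_pow_iff _ _).2 hk).le
    · rw [norm_natCast_mul_pow]
      exact mul_le_of_le_one_left (pow_nonneg hq.le _) (by
        simpa using Padic.norm_int_le_one (p := p) k)

lemma eq_of_norm_sub_le {x : ℚ_[p]} {m k l : ℕ} (hk : k < p) (hl : l < p)
    (h1 : ‖x - (k : ℚ_[p]) * (p : ℚ_[p]) ^ m‖ ≤ (p : ℝ)⁻¹ ^ (m + 1))
    (h2 : ‖x - (l : ℚ_[p]) * (p : ℚ_[p]) ^ m‖ ≤ (p : ℝ)⁻¹ ^ (m + 1)) : k = l := by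
  have hq := inv_cast_pos p
  have h3 : ‖((k - l : ℤ) : ℚ_[p])‖ * (p : ℝ)⁻¹ ^ m < (p : ℝ)⁻¹ ^ m := by
    rw [← norm_lt_inv_pow_iff] at h1 h2
    have h4 : ((k - l : ℤ) : ℚ_[p]) * (p : ℚ_[p]) ^ m
        = (x - l * (p : ℚ_[p]) ^ m) + -(x - k * (p : ℚ_[p]) ^ m) := by
      push_cast; ring
    calc ‖((k - l : ℤ) : ℚ_[p])‖ * (p : ℝ)⁻¹ ^ m
        = ‖((k - l : ℤ) : ℚ_[p]) * (p : ℚ_[p]) ^ m‖ := by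
          rw [norm_mul, norm_pow, Padic.norm_p]
      _ ≤ _ := by rw [h4]; exact Padic.nonarchimedean _ _
      _ < _ := max_lt h2 (by rwa [norm_neg])
  have h5 : ‖((k - l : ℤ) : ℚ_[p])‖ < 1 := by
    by_contra h
    exact absurd h3 (not_lt.2 (le_mul_of_one_le_left (pow_nonneg hq.le _) (not_lt.1 h)))
  have h6 : (p : ℤ) ∣ k - l := (Padic.norm_intCast_lt_one_iff).1 h5
  have h7 : (k - l : ℤ) = 0 := by
    apply Int.eq_zero_of_abs_lt_dvd h6
    rw [abs_lt]
    constructor <;> omega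
  omega

end Norm

section Measure

lemma measure_eq_mul_of_translates {G : Type*} [AddCommGroup G] [TopologicalSpace G]
    [IsTopologicalAddGroup G] [MeasurableSpace G] [BorelSpace G]
    (μ : Measure G) [μ.IsAddHaarMeasure] (p : ℕ) (A B : Set G) (v : ℕ → G) (hB : MeasurableSet B)
    (hA : ∀ z, z ∈ A ↔ ∃ k < p, z - v k ∈ B)
    (hd : ∀ z, ∀ k < p, ∀ l < p, z - v k ∈ B → z - v l ∈ B → k = l) :
    μ A = p * μ B := by
  have hAu : A = ⋃ k ∈ Finset.range p, (fun z => z + -v k) ⁻¹' B := by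
    ext z
    simp [hA, sub_eq_add_neg]
  have hmeas : ∀ k, MeasurableSet ((fun z => z + -v k) ⁻¹' B) := fun k =>
    (continuous_add_const (-v k)).measurable hB
  rw [hAu, measure_biUnion_finset]
  · simp [measure_preimage_add_right]
  · intro k hk l hl hkl
    rw [Function.onFun, Set.disjoint_left]
    intro z hz hz'
    simp only [Finset.coe_range, Set.mem_Iio] at hk hl
    simp only [Set.mem_preimage, ← sub_eq_add_neg] at hz hz'
    exact hkl (hd z k hk l hl hz hz')
  · exact fun k _ => hmeas k

variable (p : ℕ) [Fact p.Prime]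

/-- The box `p^m ℤ_p × p^n ℤ_p`. -/
def box (m n : ℕ) : Set (ℚ_[p] × ℚ_[p]) :=
  {z | ‖z.1‖ ≤ (p : ℝ)⁻¹ ^ m ∧ ‖z.2‖ ≤ (p : ℝ)⁻¹ ^ n}

/-- The pairs `(x, y)` with `x` of valuation `m` and `y` of valuation `n`. -/
def cell (m n : ℕ) : Set (ℚ_[p] × ℚ_[p]) :=
  {z | ‖z.1‖ = (p : ℝ)⁻¹ ^ m ∧ ‖z.2‖ = (p : ℝ)⁻¹ ^ n}

lemma box_anti {m n m' n' : ℕ} (hm : m ≤ m') (hn : n ≤ n') : box p m' n' ⊆ box p m n :=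
  fun _ hz =>
    ⟨hz.1.trans (pow_le_pow_of_le_one (inv_cast_pos p).le (inv_cast_lt_one p).le hm),
      hz.2.trans (pow_le_pow_of_le_one (inv_cast_pos p).le (inv_cast_lt_one p).le hn)⟩

lemma cell_subset_box (m n : ℕ) : cell p m n ⊆ box p m n :=
  fun _ hz => ⟨hz.1.le, hz.2.le⟩

lemma cell_eq (m n : ℕ) :
    cell p m n =
      (box p m n \ box p (m + 1) n) \ (box p m (n + 1) \ box p (m + 1) (n + 1)) := by
  ext z
  simp only [cell, box, Set.mem_ofPred_eq, Set.mem_sdiff, norm_eq_inv_pow_iff]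
  tauto

lemma measure_box_ne_top [MeasurableSpace (ℚ_[p] × ℚ_[p])]
    {μ : Measure (ℚ_[p] × ℚ_[p])} (hμ : μ (box p 0 0) = 1) (m n : ℕ) :
    μ (box p m n) ≠ ⊤ :=
  measure_ne_top_of_subset (box_anti p (Nat.zero_le m) (Nat.zero_le n)) (by simp [hμ])

variable [MeasurableSpace (ℚ_[p] × ℚ_[p])] [BorelSpace (ℚ_[p] × ℚ_[p])]

lemma measurableSet_box (m n : ℕ) : MeasurableSet (box p m n) :=
  ((isClosed_le continuous_fst.norm continuous_const).inter
    (isClosed_le continuous_snd.norm continuous_const)).measurableSet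

lemma measurableSet_cell (m n : ℕ) : MeasurableSet (cell p m n) :=
  ((isClosed_eq continuous_fst.norm continuous_const).inter
    (isClosed_eq continuous_snd.norm continuous_const)).measurableSet

lemma measure_box_succ_left (μ : Measure (ℚ_[p] × ℚ_[p])) [μ.IsAddHaarMeasure] (m n : ℕ) :
    μ (box p m n) = p * μ (box p (m + 1) n) := by
  refine measure_eq_mul_of_translates μ p _ _ (fun k => ((k : ℚ_[p]) * (p : ℚ_[p]) ^ m, 0))
    (measurableSet_box p _ _) (fun z => ?_) (fun z k hk l hl h1 h2 => ?_)
  · simp only [box, Set.mem_ofPred_eq, norm_le_inv_pow_iff_exists z.1 m, Prod.fst_sub,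
      Prod.snd_sub, sub_zero]
    tauto
  · exact eq_of_norm_sub_le hk hl h1.1 h2.1

lemma measure_box_succ_right (μ : Measure (ℚ_[p] × ℚ_[p])) [μ.IsAddHaarMeasure] (m n : ℕ) :
    μ (box p m n) = p * μ (box p m (n + 1)) := by
  refine measure_eq_mul_of_translates μ p _ _ (fun k => (0, (k : ℚ_[p]) * (p : ℚ_[p]) ^ n))
    (measurableSet_box p _ _) (fun z => ?_) (fun z k hk l hl h1 h2 => ?_)
  · simp only [box, Set.mem_ofPred_eq, norm_le_inv_pow_iff_exists z.2 n, Prod.fst_sub,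
      Prod.snd_sub, sub_zero]
    tauto
  · exact eq_of_norm_sub_le hk hl h1.2 h2.2

lemma measureReal_box {μ : Measure (ℚ_[p] × ℚ_[p])} [μ.IsAddHaarMeasure]
    (hμ : μ (box p 0 0) = 1) (m n : ℕ) :
    μ.real (box p m n) = (p : ℝ)⁻¹ ^ (m + n) := by
  have hp0 : (p : ℝ) ≠ 0 := Nat.cast_ne_zero.2 (Fact.out : p.Prime).ne_zero
  have hl : ∀ m n, μ.real (box p (m + 1) n) = (p : ℝ)⁻¹ * μ.real (box p m n) := fun m n => by
    simp [measureReal_def, measure_box_succ_left p μ m n, hp0]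
  have hr : ∀ m n, μ.real (box p m (n + 1)) = (p : ℝ)⁻¹ * μ.real (box p m n) := fun m n => by
    simp [measureReal_def, measure_box_succ_right p μ m n, hp0]
  induction m with
  | zero =>
    induction n with
    | zero => simp [measureReal_def, hμ]
    | succ n ih => rw [hr, ih, ← add_assoc, pow_succ']
  | succ m ih => rw [hl, ih, add_right_comm, pow_succ']

lemma measureReal_cell {μ : Measure (ℚ_[p] × ℚ_[p])} [μ.IsAddHaarMeasure]
    (hμ : μ (box p 0 0) = 1) (m n : ℕ) :
   
    μ.real (cell p m n) = (1 - (p : ℝ)⁻¹) ^ 2 * (p : ℝ)⁻¹ ^ (m + n) := by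
  have hfin := measure_box_ne_top p hμ
  have hdiff : ∀ n, μ.real (box p m n \ box p (m + 1) n)
      = (p : ℝ)⁻¹ ^ (m + n) - (p : ℝ)⁻¹ ^ (m + 1 + n) := fun n => by
    rw [measureReal_sdiff (box_anti p m.le_succ le_rfl) (measurableSet_box p _ _) (hfin _ _),
      measureReal_box p hμ, measureReal_box p hμ]
  have hsub : box p m (n + 1) \ box p (m + 1) (n + 1) ⊆ box p m n \ box p (m + 1) n :=
    fun z hz => ⟨box_anti p le_rfl n.le_succ hz.1, fun h => hz.2 ⟨h.1, hz.1.2⟩⟩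
  rw [cell_eq, measureReal_sdiff hsub ((measurableSet_box p _ _).diff (measurableSet_box p _ _))
    (measure_ne_top_of_subset Set.sdiff_subset (hfin _ _)), hdiff, hdiff]
  ring

lemma measure_axes {μ : Measure (ℚ_[p] × ℚ_[p])} [μ.IsAddHaarMeasure]
    (hμ : μ (box p 0 0) = 1) :
    μ {z | (‖z.1‖ ≤ 1 ∧ ‖z.2‖ ≤ 1) ∧ (z.1 = 0 ∨ z.2 = 0)} = 0 := by
  have hfin := measure_box_ne_top p hμ
  have key : ∀ t : Set (ℚ_[p] × ℚ_[p]), ∀ f : ℕ → ℕ × ℕ, (∀ k, t ⊆ box p (f k).1 (f k).2) →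
      (∀ k, k ≤ (f k).1 + (f k).2) → μ t = 0 := by
    intro t f ht hf
    have hft : μ t ≠ ⊤ := measure_ne_top_of_subset (ht 0) (hfin _ _)
    rw [← measureReal_eq_zero_iff hft]
    refine le_antisymm ?_ measureReal_nonneg
    refine ge_of_tendsto' (tendsto_pow_atTop_nhds_zero_of_lt_one (inv_cast_pos p).le
      (inv_cast_lt_one p)) fun k => ?_
    refine (measureReal_mono (ht k) (hfin _ _)).trans ?_
    rw [measureReal_box p hμ]
    exact pow_le_pow_of_le_one (inv_cast_pos p).le (inv_cast_lt_one p).le (hf k)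
  have h1 := key {z | z.1 = 0 ∧ ‖z.2‖ ≤ 1} (fun k => (k, 0))
    (fun k z hz => ⟨by simp [hz.1], by simpa using hz.2⟩) (by simp)
  have h2 := key {z | ‖z.1‖ ≤ 1 ∧ z.2 = 0} (fun k => (0, k))
    (fun k z hz => ⟨by simpa using hz.1, by simp [hz.2]⟩) (by simp)
  refine measure_mono_null ?_ (measure_union_null h1 h2)
  rintro z ⟨⟨hx, hy⟩, h | h⟩
  · exact Or.inl ⟨h, hy⟩
  · exact Or.inr ⟨hx, h⟩

end Measure

section Series

/-- Parametrization of the pairs `(i, j)` by the position of `j + 1` with respect to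
`2 * (i + 1)`, `i + 1` and `(i + 1) / 2`. -/
def pairParam : ((ℕ × ℕ) ⊕ (ℕ × ℕ)) ⊕ ((ℕ × ℕ) ⊕ (ℕ × ℕ)) → ℕ × ℕ :=
  Sum.elim
    (Sum.elim (fun c => (c.1, 2 * c.1 + 1 + c.2)) (fun c => (2 * c.1 + 1 + c.2, c.1)))
    (Sum.elim (fun c => (c.1 + c.2, 2 * c.1 + c.2))
      (fun c => (2 * c.1 + 2 + c.2, c.1 + 1 + c.2)))

lemma pairParam_bijective : Function.Bijective pairParam := by
  constructor
  · rintro ((⟨a, b⟩ | ⟨a, b⟩) | (⟨a, b⟩ | ⟨a, b⟩)) ((⟨c, d⟩ | ⟨c, d⟩) | (⟨c, d⟩ | ⟨c, d⟩)) h <;>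
    simp only [pairParam, Sum.elim_inl, Sum.elim_inr, Prod.mk.injEq, Sum.inl.injEq,
      Sum.inr.injEq, reduceCtorEq] at h ⊢ <;> omega
  · rintro ⟨i, j⟩
    rcases le_or_gt (2 * i + 1) j with h | h
    · exact ⟨.inl (.inl (i, j - (2 * i + 1))), Prod.ext rfl (Nat.add_sub_cancel' h)⟩
    rcases le_or_gt (2 * j + 1) i with h' | h'
    · exact ⟨.inl (.inr (j, i - (2 * j + 1))), Prod.ext (Nat.add_sub_cancel' h') rfl⟩
    rcases le_or_gt i j with h'' | h''
    · refine ⟨.inr (.inl (j - i, 2 * i - j)), ?_⟩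
      simp only [pairParam, Sum.elim_inl, Sum.elim_inr, Prod.mk.injEq]
      omega
    · refine ⟨.inr (.inr (i - j - 1, 2 * j - i)), ?_⟩
      simp only [pairParam, Sum.elim_inr, Prod.mk.injEq]
      omega

lemma hasSum_geometric_mul_geometric {x y : ℂ} (hx : ‖x‖ < 1) (hy : ‖y‖ < 1) :
    HasSum (fun c : ℕ × ℕ => x ^ c.1 * y ^ c.2) ((1 - x)⁻¹ * (1 - y)⁻¹) :=
  (hasSum_geometric_of_norm_lt_one hx).mul (hasSum_geometric_of_norm_lt_one hy)
    (summable_mul_of_summable_norm (summable_norm_geometric_of_norm_lt_one hx)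
      (summable_norm_geometric_of_norm_lt_one hy))

/-- The exponent governing the integrand on the cell of valuations `(m, n)`. -/
def cellExp (m n : ℕ) : ℤ := min (m : ℤ) (2 * n) - min (n : ℤ) (2 * m)

lemma hasSum_cells {q W : ℂ} (hq : ‖q‖ < 1) (hA : ‖q ^ 3 * W‖ < 1)
    (hB : ‖q ^ 3 * W⁻¹‖ < 1) :
    HasSum (fun c : ℕ × ℕ =>
        q ^ (c.1 + 1 + (c.2 + 1)) * W ^ cellExp (c.1 + 1) (c.2 + 1))
      ((q ^ 3 * W⁻¹ * ((1 - q ^ 3 * W⁻¹)⁻¹ * (1 - q)⁻¹) +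
          q ^ 3 * W * ((1 - q ^ 3 * W)⁻¹ * (1 - q)⁻¹)) +
        (q ^ 2 * ((1 - q ^ 3 * W⁻¹)⁻¹ * (1 - q ^ 2)⁻¹) +
          q ^ 5 * W * ((1 - q ^ 3 * W)⁻¹ * (1 - q ^ 2)⁻¹))) := by
  have hq2 : ‖q ^ 2‖ < 1 := by
    rw [norm_pow]
    exact pow_lt_one₀ (norm_nonneg _) hq two_ne_zero
  rw [← (Equiv.ofBijective _ pairParam_bijective).hasSum_iff]
  refine HasSum.sum (HasSum.sum ?_ ?_) (HasSum.sum ?_ ?_)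
  · refine HasSum.congr_fun
      ((hasSum_geometric_mul_geometric hB hq).mul_left (q ^ 3 * W⁻¹)) fun c => ?_
    have h : cellExp (c.1 + 1) (2 * c.1 + 1 + c.2 + 1) = -((c.1 + 1 : ℕ) : ℤ) := by
      unfold cellExp; omega
    simp only [Function.comp, Equiv.ofBijective_apply, pairParam, Sum.elim_inl, h,
      zpow_neg, zpow_natCast, mul_pow, inv_pow, pow_succ W, mul_inv]
    ring
  · refine HasSum.congr_fun
      ((hasSum_geometric_mul_geometric hA hq).mul_left (q ^ 3 * W)) fun c => ?_
    have h : cellExp (2 * c.1 + 1 + c.2 + 1) (c.1 + 1) = ((c.1 + 1 : ℕ) : ℤ) := by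
      unfold cellExp; omega
    simp only [Function.comp, Equiv.ofBijective_apply, pairParam, Sum.elim_inl, Sum.elim_inr, h,
      zpow_natCast]
    ring
  · refine HasSum.congr_fun
      ((hasSum_geometric_mul_geometric hB hq2).mul_left (q ^ 2)) fun c => ?_
    have h : cellExp (c.1 + c.2 + 1) (2 * c.1 + c.2 + 1) = -(c.1 : ℤ) := by
      unfold cellExp; omega
    simp only [Function.comp, Equiv.ofBijective_apply, pairParam, Sum.elim_inl, Sum.elim_inr, h,
      zpow_neg, zpow_natCast, mul_pow, inv_pow]
    ring
  · refine HasSum.congr_fun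
      ((hasSum_geometric_mul_geometric hA hq2).mul_left (q ^ 5 * W)) fun c => ?_
    have h : cellExp (2 * c.1 + 2 + c.2 + 1) (c.1 + 1 + c.2 + 1) = ((c.1 + 1 : ℕ) : ℤ) := by
      unfold cellExp; omega
    simp only [Function.comp, Equiv.ofBijective_apply, pairParam, Sum.elim_inr, h,
      zpow_natCast]
    ring

lemma cells_closed_form {P W : ℂ} (hP : P ≠ 0) (hW : W ≠ 0) (h1 : 1 - P⁻¹ ≠ 0)
    (h2 : 1 - P⁻¹ ^ 2 ≠ 0) (hA : 1 - P⁻¹ ^ 3 * W ≠ 0) (hB : 1 - P⁻¹ ^ 3 * W⁻¹ ≠ 0) :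
    (1 - P⁻¹) ^ 2 *
        ((P⁻¹ ^ 3 * W⁻¹ * ((1 - P⁻¹ ^ 3 * W⁻¹)⁻¹ * (1 - P⁻¹)⁻¹) +
            P⁻¹ ^ 3 * W * ((1 - P⁻¹ ^ 3 * W)⁻¹ * (1 - P⁻¹)⁻¹)) +
          (P⁻¹ ^ 2 * ((1 - P⁻¹ ^ 3 * W⁻¹)⁻¹ * (1 - P⁻¹ ^ 2)⁻¹) +
            P⁻¹ ^ 5 * W * ((1 - P⁻¹ ^ 3 * W)⁻¹ * (1 - P⁻¹ ^ 2)⁻¹))) =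
      (P - 1) * (P ^ 4 * W + P ^ 4 * W⁻¹ + P ^ 5 - P ^ 4 + P ^ 3 - P ^ 2 - P - 1) /
        (P ^ 2 * (P ^ 3 * W - 1) * (P ^ 3 * W⁻¹ - 1)) := by
  have e1 : 1 - P⁻¹ = (P - 1) / P := by field_simp
  have e2 : 1 - P⁻¹ ^ 2 = (P - 1) * (P + 1) / P ^ 2 := by field_simp; ring
  have eA : 1 - P⁻¹ ^ 3 * W = (P ^ 3 - W) / P ^ 3 := by field_simp
  have eB : 1 - P⁻¹ ^ 3 * W⁻¹ = (P ^ 3 * W - 1) / (P ^ 3 * W) := by field_simp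
  have eC : P ^ 3 * W⁻¹ - 1 = (P ^ 3 - W) / W := by field_simp
  rw [e1] at h1
  rw [e2] at h2
  rw [eA] at hA
  rw [eB] at hB
  have n1 := (div_ne_zero_iff.1 h1).1
  have n2 := right_ne_zero_of_mul (div_ne_zero_iff.1 h2).1
  have nA := (div_ne_zero_iff.1 hA).1
  have nB := (div_ne_zero_iff.1 hB).1
  rw [e1, e2, eA, eB, eC]
  field_simp
  ring

end Series

section Integrand

lemma ofReal_sq_zpow_cpow {x : ℝ} (hx : 0 < x) (d : ℤ) (s : ℂ) :
    (((x ^ 2) ^ d : ℝ) : ℂ) ^ s = ((x : ℂ) ^ (2 * s)) ^ d := by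
  have h : (((x ^ 2) ^ d : ℝ) : ℂ) ≠ 0 := ofReal_ne_zero.2 (by positivity)
  rw [cpow_def_of_ne_zero h, cpow_def_of_ne_zero (ofReal_ne_zero.2 hx.ne'), ← exp_int_mul,
    ← ofReal_log (by positivity), ← ofReal_log hx.le, Real.log_zpow, Real.log_pow]
  push_cast
  ring_nf

variable {p : ℕ} [Fact p.Prime]

lemma max_inv_pow (m n : ℕ) :
    max ((p : ℝ)⁻¹ ^ m) ((p : ℝ)⁻¹ ^ n) = (p : ℝ)⁻¹ ^ min m n :=
  ((pow_right_anti₀ (inv_cast_pos p).le (inv_cast_lt_one p).le).map_min).symm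

lemma norm_integrand (hp : p % 4 = 3) {m n : ℕ} {z : ℚ_[p] × ℚ_[p]} (hz : z ∈ cell p m n) :
    ‖(z.2 ^ 2 + z.1 ^ 4) / (z.1 ^ 2 + z.2 ^ 4)‖ = ((p : ℝ) ^ 2) ^ cellExp m n := by
  have hp0 : (p : ℝ) ≠ 0 := Nat.cast_ne_zero.2 (Fact.out : p.Prime).ne_zero
  have h4 : ∀ x : ℚ_[p], x ^ 4 = (x ^ 2) ^ 2 := fun x => by ring
  rw [norm_div, h4, h4, norm_sq_add_sq hp, norm_sq_add_sq hp, norm_pow, norm_pow, hz.1, hz.2,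
    ← pow_mul, ← pow_mul, max_inv_pow, max_inv_pow]
  have h : cellExp m n = ((min m (n * 2) : ℕ) : ℤ) - ((min n (m * 2) : ℕ) : ℤ) := by
    unfold cellExp; omega
  rw [h, zpow_sub₀ (pow_ne_zero _ hp0), zpow_natCast, zpow_natCast]
  simp only [inv_pow, ← pow_mul, mul_comm 2]
  field_simp

variable (p) in
lemma cell_disjoint : Pairwise (Function.onFun Disjoint
    fun c : ℕ × ℕ => cell p (c.1 + 1) (c.2 + 1)) := by
  intro c d hcd
  rw [Function.onFun, Set.disjoint_left]
  intro z hz hz'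
  have h1 := inv_pow_injective (hz.1.symm.trans hz'.1)
  have h2 := inv_pow_injective (hz.2.symm.trans hz'.2)
  exact hcd (Prod.ext (Nat.succ_injective h1) (Nat.succ_injective h2))

variable (p) in
lemma domain_ae_eq [MeasurableSpace (ℚ_[p] × ℚ_[p])] [BorelSpace (ℚ_[p] × ℚ_[p])]
    {μ : Measure (ℚ_[p] × ℚ_[p])} [μ.IsAddHaarMeasure] (hμ : μ (box p 0 0) = 1) :
    ({z : ℚ_[p] × ℚ_[p] | ‖z.1‖ ≤ (p : ℝ)⁻¹ ∧ ‖z.2‖ ≤ (p : ℝ)⁻¹} \ {(0, 0)} : Set _) =ᵐ[μ]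
      ⋃ c : ℕ × ℕ, cell p (c.1 + 1) (c.2 + 1) := by
  have hq1 := (inv_cast_lt_one p).le
  have hq0 := inv_cast_pos p
  have hax : ∀ᵐ z ∂μ, ¬ ((‖z.1‖ ≤ 1 ∧ ‖z.2‖ ≤ 1) ∧ (z.1 = 0 ∨ z.2 = 0)) := by
    rw [ae_iff]
    simpa only [not_not] using measure_axes p hμ
  refine Filter.eventuallyEq_set.2 ?_
  filter_upwards [hax] with z hz
  simp only [Set.mem_sdiff, Set.mem_ofPred_eq, Set.mem_singleton_iff, Set.mem_iUnion]
  constructor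
  · rintro ⟨⟨hx, hy⟩, -⟩
    have h0 : ¬ (z.1 = 0 ∨ z.2 = 0) := fun h => hz ⟨⟨hx.trans hq1, hy.trans hq1⟩, h⟩
    rw [not_or] at h0
    obtain ⟨m, hm⟩ := exists_norm_eq_inv_pow h0.1 hx
    obtain ⟨n, hn⟩ := exists_norm_eq_inv_pow h0.2 hy
    exact ⟨(m, n), hm, hn⟩
  · rintro ⟨c, hx, hy⟩
    refine ⟨⟨?_, ?_⟩, ?_⟩
    · rw [hx]
      exact pow_le_of_le_one hq0.le hq1 (Nat.succ_ne_zero _)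
    · rw [hy]
      exact pow_le_of_le_one hq0.le hq1 (Nat.succ_ne_zero _)
    · rintro rfl
      simp only [norm_zero] at hx
      exact (pow_pos hq0 _).ne hx

end Integrand

/-- A function that is constant on each piece of a countable partition is integrable with integral
`a` as soon as the weighted sum of its values converges to `a`. -/
lemma integrableOn_and_integral_eq_of_hasSum {X ι : Type*} [MeasurableSpace X] [Countable ι]
    {μ : Measure X} {f : X → ℂ} {s : ι → Set X} {c : ι → ℂ} {a : ℂ}
    (hs : ∀ i, MeasurableSet (s i)) (hd : Pairwise (Function.onFun Disjoint s))
    (hfin : ∀ i, μ (s i) ≠ ⊤) (hf : ∀ i, ∀ x ∈ s i, f x = c i)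
    (ha : HasSum (fun i => μ.real (s i) • c i) a) :
    IntegrableOn f (⋃ i, s i) μ ∧ ∫ x in ⋃ i, s i, f x ∂μ = a := by
  have hint : ∀ i, ∫ x in s i, f x ∂μ = μ.real (s i) • c i := fun i => by
    rw [setIntegral_congr_fun (hs i) (hf i), setIntegral_const]
  have hi : IntegrableOn f (⋃ i, s i) μ := by
    refine integrableOn_iUnion_of_summable_integral_norm (fun i => ?_) ?_
    · exact (integrableOn_const (hfin i)).congr_fun (fun x hx => (hf i x hx).symm) (hs i)
    · refine ha.summable.norm.congr fun i => ?_
      rw [setIntegral_congr_fun (hs i) (fun x hx => congrArg norm (hf i x hx)), setIntegral_const,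
        norm_smul, smul_eq_mul, Real.norm_of_nonneg measureReal_nonneg]
  refine ⟨hi, (hasSum_integral_iUnion hs hd hi).unique ?_⟩
  simpa only [hint] using ha

lemma norm_inv_pow_three_mul_cpow_lt_one {p : ℕ} (hp : 1 < p) {t : ℂ} (ht : t.re < 3) :
    ‖((p : ℂ)⁻¹) ^ 3 * (p : ℂ) ^ t‖ < 1 := by
  have hp0 : 0 < p := zero_lt_one.trans hp
  have hp1 : (1 : ℝ) < p := Nat.one_lt_cast.2 hp
  rw [norm_mul, norm_pow, norm_inv, Complex.norm_natCast, norm_natCast_cpow_of_pos hp0, inv_pow,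
    inv_mul_lt_iff₀ (by positivity), mul_one, ← Real.rpow_natCast]
  exact Real.rpow_lt_rpow_of_exponent_lt hp1 (by exact_mod_cast ht)

end PadicZeta

open PadicZeta in
/-- Explicit local zeta function of `(y²+x⁴)/(x²+y⁴)` on `(pℤ_p)²`, for `p ≡ 3 (mod 4)`. -/
theorem padic_zeta_example_four
    (p : ℕ) [Fact p.Prime] (hp : p % 4 = 3)
    [MeasurableSpace (ℚ_[p] × ℚ_[p])] [BorelSpace (ℚ_[p] × ℚ_[p])]
    (μ : Measure (ℚ_[p] × ℚ_[p])) [μ.IsAddHaarMeasure]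
    (hμ : μ {z : ℚ_[p] × ℚ_[p] | ‖z.1‖ ≤ 1 ∧ ‖z.2‖ ≤ 1} = 1) :
    ∀ s : ℂ, -(3 / 2 : ℝ) < s.re → s.re < 3 / 2 →
      IntegrableOn
        (fun z : ℚ_[p] × ℚ_[p] =>
          ((‖(z.2 ^ 2 + z.1 ^ 4) / (z.1 ^ 2 + z.2 ^ 4)‖ : ℝ) : ℂ) ^ s)
        ({z : ℚ_[p] × ℚ_[p] | ‖z.1‖ ≤ (p : ℝ)⁻¹ ∧ ‖z.2‖ ≤ (p : ℝ)⁻¹} \ {(0, 0)}) μ ∧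
      ∫ z in ({z : ℚ_[p] × ℚ_[p] | ‖z.1‖ ≤ (p : ℝ)⁻¹ ∧ ‖z.2‖ ≤ (p : ℝ)⁻¹} \ {(0, 0)}),
          ((‖(z.2 ^ 2 + z.1 ^ 4) / (z.1 ^ 2 + z.2 ^ 4)‖ : ℝ) : ℂ) ^ s ∂μ =
        ((p : ℂ) - 1) *
            ((p : ℂ) ^ ((4 : ℂ) + 2 * s) + (p : ℂ) ^ ((4 : ℂ) - 2 * s) +
              (p : ℂ) ^ 5 - (p : ℂ) ^ 4 + (p : ℂ) ^ 3 - (p : ℂ) ^ 2 - (p : ℂ) - 1) /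
          ((p : ℂ) ^ 2 * ((p : ℂ) ^ ((3 : ℂ) + 2 * s) - 1) *
            ((p : ℂ) ^ ((3 : ℂ) - 2 * s) - 1)) := by
  intro s hs1 hs2
  have hprime : p.Prime := Fact.out
  have hpC : (p : ℂ) ≠ 0 := Nat.cast_ne_zero.2 hprime.ne_zero
  have hbox : μ (box p 0 0) = 1 := by simpa only [box, pow_zero] using hμ
  set W : ℂ := (p : ℂ) ^ (2 * s) with hW
  have hW0 : W ≠ 0 := by simp [hW, cpow_eq_zero_iff, hpC]
  have hWinv : (p : ℂ) ^ (-(2 * s)) = W⁻¹ := cpow_neg _ _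
  have hq : ‖(p : ℂ)⁻¹‖ < 1 := by
    rw [norm_inv, Complex.norm_natCast]
    exact inv_cast_lt_one p
  have hA : ‖((p : ℂ)⁻¹) ^ 3 * W‖ < 1 :=
    norm_inv_pow_three_mul_cpow_lt_one hprime.one_lt (by simp; linarith)
  have hB : ‖((p : ℂ)⁻¹) ^ 3 * W⁻¹‖ < 1 := by
    rw [← hWinv]
    exact norm_inv_pow_three_mul_cpow_lt_one hprime.one_lt (by simp; linarith)
  have hsum := (hasSum_cells hq hA hB).mul_left ((1 - (p : ℂ)⁻¹) ^ 2)
  have hdom := domain_ae_eq p hbox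
  rw [integrableOn_congr_set_ae hdom, setIntegral_congr_set hdom]
  refine (integrableOn_and_integral_eq_of_hasSum
    (c := fun c : ℕ × ℕ => W ^ cellExp (c.1 + 1) (c.2 + 1))
    (fun c => measurableSet_cell p _ _) (cell_disjoint p)
    (fun c => measure_ne_top_of_subset (cell_subset_box p _ _)
      (measure_box_ne_top p hbox _ _))
    (fun c z hz => ?_) (hsum.congr_fun fun c => ?_)).imp_right fun h => h.trans ?_
  · simp only [norm_integrand hp hz]
    rw [ofReal_sq_zpow_cpow (Nat.cast_pos.2 hprime.pos), ofReal_natCast]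
  · rw [measureReal_cell p hbox, real_smul]
    push_cast
    ring
  · have hne : ∀ {x : ℂ}, ‖x‖ < 1 → 1 - x ≠ 0 := fun {x} hx h => by
      rw [← sub_eq_zero.1 h, norm_one] at hx
      exact lt_irrefl _ hx
    have hq2 : ‖(p : ℂ)⁻¹ ^ 2‖ < 1 := by
      rw [norm_pow]
      exact pow_lt_one₀ (norm_nonneg _) hq two_ne_zero
    have c1 : ∀ k : ℕ, (p : ℂ) ^ ((k : ℂ) + 2 * s) = (p : ℂ) ^ k * W := fun k => by
      rw [cpow_add _ _ hpC, cpow_natCast]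
    have c2 : ∀ k : ℕ, (p : ℂ) ^ ((k : ℂ) - 2 * s) = (p : ℂ) ^ k * W⁻¹ := fun k => by
      rw [sub_eq_add_neg, cpow_add _ _ hpC, cpow_natCast, hWinv]
    have c14 := c1 4
    have c13 := c1 3
    have c24 := c2 4
    have c23 := c2 3
    push_cast at c14 c13 c24 c23
    rw [c14, c13, c24, c23]
    exact cells_closed_form hpC hW0 (hne hq) (hne hq2) (hne hA) (hne hB)
end
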